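/- For every nonnegative integer k, the probability that a uniformly random tanglegram of size n has exactly k matched cherries converges, as n → ∞, to e^{−1/4}·4^{−k}/k!; that is, the number of matched cherries converges in distribution to a Poisson distribution with mean 1/4. -/

import Mathlib

open scoped Classical

inductive PTree : Type
  | leaf : PTree
  | node : PTree → PTree → PTree
deriving DecidableEq

namespace PTree

def size : PTree → ℕ
  | leaf => 1
  | node l r => size l + size r

def cherries : PTree → ℕ
  | leaf => 0
  | node leaf leaf => 1
  | node l r => cherries l + cherries r

def height : PTree → ℕ
  | leaf => 0
  | node l r => max (height l) (height r) + 1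

def encode : PTree → ℕ
  | leaf => 0
  | node l r => Nat.pair (encode l) (encode r) + 1

def normalize : PTree → PTree
  | leaf => leaf
  | node l r =>
      let l' := normalize l
      let r' := normalize r
      if encode l' ≤ encode r' then node l' r' else node r' l'

def isoFuns : PTree → PTree → List (ℕ → ℕ)
  | leaf, leaf => [fun i => i]
  | node l r, node l' r' =>
      ((isoFuns l l').flatMap fun g => (isoFuns r r').map fun h =>
        fun i => if i < l.size then g i else h (i - l.size) + l'.size)
      ++
      ((isoFuns l r').flatMap fun g => (isoFuns r l').map fun h =>
        fun i => if i < l.size then g i + l'.size else h (i - l.size))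
  | _, _ => []

def planeTrees : ℕ → Finset PTree
  | 0 => ∅
  | 1 => {leaf}
  | n + 2 =>
      (Finset.range (n + 1)).attach.biUnion fun k =>
        ((planeTrees (k.1 + 1)) ×ˢ (planeTrees (n + 1 - k.1))).image
          fun p => node p.1 p.2
  termination_by n => n
  decreasing_by
  · have := Finset.mem_range.mp k.2; omega
  · omega

def binTrees (n : ℕ) : Finset PTree := (planeTrees n).image normalize

/-- Triples (T, v, S): left plane tree, right plane tree, and a matching `v`
(a permutation of `0, …, n-1`, encoded as the list of its values) matching
leaf `i` of `T` with leaf `v i` of `S`. -/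
def Triples (n : ℕ) : Finset (PTree × PTree × List ℕ) :=
  (planeTrees n) ×ˢ ((planeTrees n) ×ˢ (List.range n).permutations.toFinset)

/-- Two triples represent the same tanglegram iff there are isomorphisms of the left
trees and of the right trees compatible with the matchings. -/
def equivTriple (n : ℕ) (t t' : PTree × PTree × List ℕ) : Bool :=
  (isoFuns t.1 t'.1).any fun φ => (isoFuns t.2.1 t'.2.1).any fun ψ =>
    (List.range n).all fun i => t'.2.2.getD (φ i) 0 == ψ (t.2.2.getD i 0)

/-- The tanglegrams of size `n`: equivalence classes of triples. -/
def tangleClasses (n : ℕ) : Finset (Finset (PTree × PTree × List ℕ)) :=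
  (Triples n).image fun t => (Triples n).filter (fun t' => equivTriple n t t' = true)

/-- The number of tanglegrams of size `n`. -/
def numTanglegrams (n : ℕ) : ℕ := (tangleClasses n).card

/-- The probability that a uniformly random tanglegram of size `n` satisfies the
(isomorphism-invariant) property `P` of triples. -/
noncomputable def tangleProb (n : ℕ) (P : PTree × PTree × List ℕ → Prop) : ℝ :=
  ((tangleClasses n).filter fun c => ∃ t ∈ c, P t).card / numTanglegrams n

/-- The expectation of the statistic `f` of a uniformly random tanglegram of size `n`. -/
noncomputable def tangleExp (n : ℕ) (f : PTree × PTree × List ℕ → ℕ) : ℝ :=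
  ∑' k : ℕ, (k : ℝ) * tangleProb n (fun t => f t = k)

end PTree

namespace PTree

/-- The distribution on pairs of binary trees (canonical representatives) induced by
the two halves of a uniformly random tanglegram of size `n`:
probability that the pair of isomorphism classes of the two trees lies in `S`. -/
noncomputable def nuT (n : ℕ) (S : Finset (PTree × PTree)) : ℝ :=
  tangleProb n fun t => (normalize t.1, normalize t.2.1) ∈ S

/-- The distribution on pairs of binary trees induced by two independent uniformly
random plane binary trees with `n` leaves. -/
noncomputable def nuP (n : ℕ) (S : Finset (PTree × PTree)) : ℝ :=
  (((planeTrees n) ×ˢ (planeTrees n)).filter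
      fun p => (normalize p.1, normalize p.2) ∈ S).card / ((planeTrees n).card ^ 2 : ℝ)

/-- The total variation distance between `nuT` and `nuP`. -/
noncomputable def tvDist (n : ℕ) : ℝ :=
  ((binTrees n ×ˢ binTrees n).powerset).sup' (Finset.powerset_nonempty _)
    fun S => |nuT n S - nuP n S|

/-- The number of occurrences of (trees isomorphic to) `B` as a fringe subtree of `T`. -/
def occ (B : PTree) : PTree → ℕ
  | leaf => if normalize leaf = normalize B then 1 else 0
  | node l r => (if normalize (node l r) = normalize B then 1 else 0) + occ B l + occ B r

/-- The number of generators of the automorphism group of `T`: the number of internal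
vertices whose two branches are isomorphic. -/
def gens : PTree → ℕ
  | leaf => 0
  | node l r => (if normalize l = normalize r then 1 else 0) + gens l + gens r

/-- `T` has a root branch isomorphic to `B`. -/
def hasBranch (B : PTree) : PTree → Prop
  | leaf => False
  | node l r => normalize l = normalize B ∨ normalize r = normalize B

/-- The cherries of a plane binary tree whose leaves are numbered from `k` on
(left to right), as pairs of leaf positions. -/
def cherryList : PTree → ℕ → List (ℕ × ℕ)
  | leaf, _ => []
  | node leaf leaf, k => [(k, k + 1)]
  | node l r, k => cherryList l k ++ cherryList r (k + l.size)

/-- The number of matched cherries: cherries of `T` whose two leaves are matched by `L`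
to the two leaves of a cherry of `S`. -/
def matchedCherries (T S : PTree) (L : List ℕ) : ℕ :=
  (cherryList T 0).countP fun p =>
    (cherryList S 0).any fun q =>
      (L.getD p.1 0 == q.1 && L.getD p.2 0 == q.2) ||
      (L.getD p.1 0 == q.2 && L.getD p.2 0 == q.1)

/-- The number of automorphisms of the tanglegram represented by the triple `(T, L, S)`:
pairs of automorphisms of the two trees compatible with the matching `L`. -/
def tangleAutCount (T S : PTree) (L : List ℕ) : ℕ :=
  ((isoFuns T T).map fun a =>
    (isoFuns S S).countP fun b =>
      (List.range T.size).all fun i => L.getD (a i) 0 == b (L.getD i 0)).sum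

/-- The number of automorphisms of `T` whose cycle type is `μ(s) = 2^s 1^(n-2s)`,
i.e. involutions of the leaves moving exactly `2 s` leaves. -/
def autMuCount (T : PTree) (s : ℕ) : ℕ :=
  (isoFuns T T).countP fun f =>
    ((List.range T.size).all fun i => f (f i) == i) &&
    ((List.range T.size).countP fun i => !(f i == i)) == 2 * s

end PTree

namespace PTree

theorem size_pos (T : PTree) : 0 < T.size := by
  induction T with
  | leaf => simp [size]
  | node l r hl hr => simp only [size]; omega

theorem mem_planeTrees {n : ℕ} {T : PTree} : T ∈ planeTrees n ↔ T.size = n := by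
  induction n using Nat.strong_induction_on generalizing T with
  | _ n ih =>
    match n with
    | 0 => simpa [planeTrees] using (size_pos T).ne'
    | 1 =>
      cases T with
      | leaf => simp [planeTrees, size]
      | node l r =>
        have := size_pos l
        have := size_pos r
        simp only [planeTrees, Finset.mem_singleton, reduceCtorEq, size, false_iff]
        omega
    | n + 2 =>
      rw [planeTrees]
      simp only [Finset.mem_biUnion, Finset.mem_attach, true_and, Finset.mem_image,
        Finset.mem_product, Prod.exists, Subtype.exists, Finset.mem_range]
      constructor
      · rintro ⟨k, hk, l, r, ⟨hl, hr⟩, rfl⟩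
        rw [ih _ (by omega)] at hl hr
        simp only [size]; omega
      · cases T with
        | leaf => simp [size]
        | node l r =>
          intro h
          have := size_pos l
          have := size_pos r
          simp only [size] at h
          exact ⟨l.size - 1, by omega, l, r,
            ⟨(ih _ (by omega)).2 (by omega), (ih _ (by omega)).2 (by omega)⟩, rfl⟩

theorem planeTrees_zero : planeTrees 0 = ∅ := by simp [planeTrees]

theorem planeTrees_one : planeTrees 1 = {leaf} := by simp [planeTrees]

theorem sum_planeTrees_add_two {M : Type*} [AddCommMonoid M] (n : ℕ) (F : PTree → M) :
    ∑ T ∈ planeTrees (n + 2), F T =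
      ∑ p ∈ Finset.HasAntidiagonal.antidiagonal (n + 2), ∑ l ∈ planeTrees p.1, ∑ r ∈ planeTrees p.2,
        F (node l r) := by
  simp_rw [← Finset.sum_product']
  rw [Finset.sum_sigma']
  symm
  refine Finset.sum_bij' (i := fun x _ => node x.2.1 x.2.2)
    (j := fun T _ => match T with
      | leaf => ⟨(0, 0), (leaf, leaf)⟩
      | node l r => ⟨(l.size, r.size), (l, r)⟩) ?_ ?_ ?_ ?_ ?_
  · rintro ⟨⟨a, b⟩, l, r⟩ h
    simp only [Finset.mem_sigma, Finset.HasAntidiagonal.mem_antidiagonal, Finset.mem_product,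
      mem_planeTrees] at h
    simp only [mem_planeTrees, size]; omega
  · intro T h
    cases T with
    | leaf => simp [mem_planeTrees, size] at h
    | node l r =>
      simp only [mem_planeTrees, size] at h
      simp [mem_planeTrees, h]
  · rintro ⟨⟨a, b⟩, l, r⟩ h
    simp only [Finset.mem_sigma, Finset.HasAntidiagonal.mem_antidiagonal, Finset.mem_product,
      mem_planeTrees] at h
    obtain ⟨-, rfl, rfl⟩ := h
    rfl
  · intro T h
    cases T with
    | leaf => simp [mem_planeTrees, size] at h
    | node l r => rfl
  · intros; rfl

theorem card_planeTrees (n : ℕ) : (planeTrees (n + 1)).card = catalan n := by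
  induction n using Nat.strong_induction_on with
  | _ n ih =>
    cases n with
    | zero => simp [planeTrees]
    | succ n =>
      rw [Finset.card_eq_sum_ones, sum_planeTrees_add_two, catalan_succ',
        Finset.Nat.sum_antidiagonal_succ, Finset.Nat.sum_antidiagonal_succ']
      simp only [planeTrees_zero, Finset.sum_empty, zero_add, Finset.sum_const_zero]
      refine Finset.sum_congr rfl fun p hp => ?_
      have := Finset.HasAntidiagonal.mem_antidiagonal.1 hp
      simp [← ih p.1 (by omega), ← ih p.2 (by omega)]

/-- The type of leaves of a plane tree. -/
def Leaf : PTree → Type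
  | leaf => Unit
  | node l r => Leaf l ⊕ Leaf r

noncomputable instance : (T : PTree) → Fintype (Leaf T)
  | leaf => inferInstanceAs (Fintype Unit)
  | node l r =>
    letI : Fintype (Leaf l) := instFintypeLeaf l
    letI : Fintype (Leaf r) := instFintypeLeaf r
    inferInstanceAs (Fintype (Leaf l ⊕ Leaf r))

theorem card_leaf (T : PTree) : Fintype.card (Leaf T) = T.size := by
  induction T with
  | leaf => rfl
  | node l r hl hr =>
    have : Fintype.card (Leaf l ⊕ Leaf r) = l.size + r.size := by
      rw [Fintype.card_sum, hl, hr]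
    rw [size, ← this]
    exact Fintype.card_congr (Equiv.refl _)

instance (T : PTree) : Nonempty (Leaf T) :=
  Fintype.card_pos_iff.1 (by rw [card_leaf]; exact size_pos T)

/-- The position of a leaf, counted from the left. -/
def pos : (T : PTree) → Leaf T → ℕ
  | leaf, _ => 0
  | node l _, Sum.inl x => pos l x
  | node l r, Sum.inr y => l.size + pos r y

theorem pos_lt {T : PTree} (x : Leaf T) : pos T x < T.size := by
  induction T with
  | leaf => simp [pos, size]
  | node l r hl hr =>
    rcases x with x | x
    · have := hl x
      simp only [pos, size]; omega
    · have := hr x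
      simp only [pos, size]; omega

theorem pos_injective (T : PTree) : Function.Injective (pos T) := by
  induction T with
  | leaf => intro x y _; rfl
  | node l r hl hr =>
    rintro (x | x) (y | y) h
    · exact congrArg Sum.inl (hl h)
    · have := pos_lt x
      simp only [pos] at h; omega
    · have := pos_lt y
      simp only [pos] at h; omega
    · simp only [pos] at h
      exact congrArg Sum.inr (hr (by omega))

theorem exists_pos_eq {T : PTree} {i : ℕ} (hi : i < T.size) : ∃ x, pos T x = i := by
  induction T generalizing i with
  | leaf => exact ⟨(), by simp only [size] at hi; simp only [pos]; omega⟩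
  | node l r hl hr =>
    simp only [size] at hi
    by_cases h : i < l.size
    · obtain ⟨x, hx⟩ := hl h
      exact ⟨Sum.inl x, hx⟩
    · obtain ⟨x, hx⟩ := hr (i := i - l.size) (by omega)
      exact ⟨Sum.inr x, by simp only [pos, hx]; omega⟩

/-- The isomorphisms of plane trees as bijections of the leaves. -/
def IsIso : (T T' : PTree) → (Leaf T ≃ Leaf T') → Prop
  | leaf, leaf, _ => True
  | node l r, node l' r', e =>
    (∃ (f : Leaf l ≃ Leaf l') (g : Leaf r ≃ Leaf r'), IsIso l l' f ∧ IsIso r r' g ∧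
      e = Equiv.sumCongr f g) ∨
    (∃ (f : Leaf l ≃ Leaf r') (g : Leaf r ≃ Leaf l'), IsIso l r' f ∧ IsIso r l' g ∧
      e = (Equiv.sumCongr f g).trans (Equiv.sumComm _ _))
  | leaf, node _ _, _ => False
  | node _ _, leaf, _ => False

theorem IsIso.refl (T : PTree) : IsIso T T (Equiv.refl _) := by
  induction T with
  | leaf => trivial
  | node l r hl hr =>
    refine Or.inl ⟨_, _, hl, hr, ?_⟩
    exact Equiv.sumCongr_refl.symm

theorem IsIso.symm {T T' : PTree} {e : Leaf T ≃ Leaf T'} (h : IsIso T T' e) :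
    IsIso T' T e.symm := by
  induction T generalizing T' with
  | leaf => cases T' with
    | leaf => trivial
    | node => exact h.elim
  | node l r hl hr => cases T' with
    | leaf => exact h.elim
    | node l' r' =>
      rcases h with ⟨f, g, hf, hg, rfl⟩ | ⟨f, g, hf, hg, rfl⟩
      · exact Or.inl ⟨_, _, hl hf, hr hg, rfl⟩
      · refine Or.inr ⟨_, _, hr hg, hl hf, ?_⟩
        refine Equiv.ext ?_
        rintro (x | x) <;> rfl

theorem IsIso.trans {T T' T'' : PTree} {e : Leaf T ≃ Leaf T'} {e' : Leaf T' ≃ Leaf T''}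
    (h : IsIso T T' e) (h' : IsIso T' T'' e') : IsIso T T'' (e.trans e') := by
  induction T generalizing T' T'' with
  | leaf => cases T' with
    | leaf => cases T'' with
      | leaf => trivial
      | node => exact h'.elim
    | node => exact h.elim
  | node l r hl hr => cases T' with
    | leaf => exact h.elim
    | node l' r' => cases T'' with
      | leaf => exact h'.elim
      | node l'' r'' =>
        rcases h with ⟨f, g, hf, hg, rfl⟩ | ⟨f, g, hf, hg, rfl⟩ <;>
        rcases h' with ⟨f', g', hf', hg', rfl⟩ | ⟨f', g', hf', hg', rfl⟩
        · refine Or.inl ⟨_, _, hl hf hf', hr hg hg', ?_⟩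
          refine Equiv.ext ?_
          rintro (x | x) <;> rfl
        · refine Or.inr ⟨_, _, hl hf hf', hr hg hg', ?_⟩
          refine Equiv.ext ?_
          rintro (x | x) <;> rfl
        · refine Or.inr ⟨_, _, hl hf hg', hr hg hf', ?_⟩
          refine Equiv.ext ?_
          rintro (x | x) <;> rfl
        · refine Or.inl ⟨_, _, hl hf hg', hr hg hf', ?_⟩
          refine Equiv.ext ?_
          rintro (x | x) <;> rfl

theorem IsIso.size_eq {T T' : PTree} {e : Leaf T ≃ Leaf T'} (_h : IsIso T T' e) :
    T.size = T'.size := by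
  rw [← card_leaf, ← card_leaf]
  exact Fintype.card_congr e

theorem exists_isIso_of_mem_isoFuns {T T' : PTree} {f : ℕ → ℕ} (h : f ∈ isoFuns T T') :
    ∃ e, IsIso T T' e ∧ ∀ x, f (pos T x) = pos T' (e x) := by
  induction T generalizing T' f with
  | leaf => cases T' with
    | leaf =>
      simp only [isoFuns, List.mem_singleton] at h
      exact ⟨Equiv.refl _, trivial, fun x => by simp [h, pos]⟩
    | node => simp [isoFuns] at h
  | node l r hl hr => cases T' with
    | leaf => simp [isoFuns] at h
    | node l' r' =>
      simp only [isoFuns, List.mem_append, List.mem_flatMap, List.mem_map] at h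
      rcases h with ⟨g, hg, k, hk, rfl⟩ | ⟨g, hg, k, hk, rfl⟩
      · obtain ⟨e, he, hge⟩ := hl hg
        obtain ⟨e', he', hke⟩ := hr hk
        refine ⟨Equiv.sumCongr e e', Or.inl ⟨e, e', he, he', rfl⟩, ?_⟩
        rintro (x | x)
        · have := pos_lt x
          simp only [pos, this, if_true]
          exact hge x
        · have : ¬ (l.size + pos r x < l.size) := by omega
          simp only [pos, this, if_false, Nat.add_sub_cancel_left, hke]
          exact Nat.add_comm _ _
      · obtain ⟨e, he, hge⟩ := hl hg
        obtain ⟨e', he', hke⟩ := hr hk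
        refine ⟨(Equiv.sumCongr e e').trans (Equiv.sumComm _ _),
          Or.inr ⟨e, e', he, he', rfl⟩, ?_⟩
        rintro (x | x)
        · have := pos_lt x
          simp only [pos, this, if_true, hge]
          exact Nat.add_comm _ _
        · have : ¬ (l.size + pos r x < l.size) := by omega
          simp only [pos, this, if_false, Nat.add_sub_cancel_left, hke]
          rfl

theorem IsIso.exists_mem_isoFuns {T T' : PTree} {e : Leaf T ≃ Leaf T'} (h : IsIso T T' e) :
    ∃ f ∈ isoFuns T T', ∀ x, f (pos T x) = pos T' (e x) := by
  induction T generalizing T' with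
  | leaf => cases T' with
    | leaf => exact ⟨fun i => i, by simp [isoFuns], fun x => by simp [pos]⟩
    | node => exact h.elim
  | node l r hl hr => cases T' with
    | leaf => exact h.elim
    | node l' r' =>
      rcases h with ⟨f, g, hf, hg, rfl⟩ | ⟨f, g, hf, hg, rfl⟩
      · obtain ⟨F, hF, hF'⟩ := hl hf
        obtain ⟨G, hG, hG'⟩ := hr hg
        refine ⟨fun i => if i < l.size then F i else G (i - l.size) + l'.size, ?_, ?_⟩
        · simp only [isoFuns, List.mem_append, List.mem_flatMap, List.mem_map]
          exact Or.inl ⟨F, hF, G, hG, rfl⟩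
        · rintro (x | x)
          · have := pos_lt x
            simp only [pos, this, if_true]
            exact hF' x
          · have : ¬ (l.size + pos r x < l.size) := by omega
            simp only [pos, this, if_false, Nat.add_sub_cancel_left, hG']
            exact Nat.add_comm _ _
      · obtain ⟨F, hF, hF'⟩ := hl hf
        obtain ⟨G, hG, hG'⟩ := hr hg
        refine ⟨fun i => if i < l.size then F i + l'.size else G (i - l.size), ?_, ?_⟩
        · simp only [isoFuns, List.mem_append, List.mem_flatMap, List.mem_map]
          exact Or.inr ⟨F, hF, G, hG, rfl⟩
        · rintro (x | x)
          · have := pos_lt x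
            simp only [pos, this, if_true, hF']
            exact Nat.add_comm _ _
          · have : ¬ (l.size + pos r x < l.size) := by omega
            simp only [pos, this, if_false, Nat.add_sub_cancel_left, hG']
            rfl

end PTree

namespace PTree

/-- The finite set of isomorphisms between two plane trees. -/
noncomputable def isos (T T' : PTree) : Finset (Leaf T ≃ Leaf T') :=
  Finset.univ.filter (IsIso T T')

theorem mem_isos {T T' : PTree} {e : Leaf T ≃ Leaf T'} : e ∈ isos T T' ↔ IsIso T T' e := by
  simp [isos]

/-- The isomorphism that maps left branch to left branch and right branch to right branch. -/
def straight {l r l' r' : PTree} (f : Leaf l ≃ Leaf l') (g : Leaf r ≃ Leaf r') :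
    Leaf (node l r) ≃ Leaf (node l' r') :=
  Equiv.sumCongr f g

/-- The isomorphism that exchanges the two branches. -/
def crossed {l r l' r' : PTree} (f : Leaf l ≃ Leaf r') (g : Leaf r ≃ Leaf l') :
    Leaf (node l r) ≃ Leaf (node l' r') :=
  (Equiv.sumCongr f g).trans (Equiv.sumComm _ _)

theorem straight_inj {l r l' r' : PTree} {f f' : Leaf l ≃ Leaf l'} {g g' : Leaf r ≃ Leaf r'}
    (h : straight f g = straight f' g') : f = f' ∧ g = g' := by
  refine ⟨Equiv.ext fun x => ?_, Equiv.ext fun x => ?_⟩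
  · exact Sum.inl_injective (DFunLike.congr_fun h (Sum.inl x : Leaf l ⊕ Leaf r))
  · exact Sum.inr_injective (DFunLike.congr_fun h (Sum.inr x : Leaf l ⊕ Leaf r))

theorem crossed_inj {l r l' r' : PTree} {f f' : Leaf l ≃ Leaf r'} {g g' : Leaf r ≃ Leaf l'}
    (h : crossed f g = crossed f' g') : f = f' ∧ g = g' := by
  refine ⟨Equiv.ext fun x => ?_, Equiv.ext fun x => ?_⟩
  · exact Sum.inr_injective (DFunLike.congr_fun h (Sum.inl x : Leaf l ⊕ Leaf r))
  · exact Sum.inl_injective (DFunLike.congr_fun h (Sum.inr x : Leaf l ⊕ Leaf r))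

theorem straight_ne_crossed {l r l' r' : PTree} (f : Leaf l ≃ Leaf l') (g : Leaf r ≃ Leaf r')
    (f' : Leaf l ≃ Leaf r') (g' : Leaf r ≃ Leaf l') : straight f g ≠ crossed f' g' := by
  intro h
  obtain ⟨x⟩ : Nonempty (Leaf l) := inferInstance
  exact Sum.inl_ne_inr (DFunLike.congr_fun h (Sum.inl x : Leaf l ⊕ Leaf r))

theorem isos_node_node (l r l' r' : PTree) :
    isos (node l r) (node l' r') =
      ((isos l l' ×ˢ isos r r').image fun p => straight p.1 p.2) ∪
      ((isos l r' ×ˢ isos r l').image fun p => crossed p.1 p.2) := by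
  ext e
  simp only [Finset.mem_union, Finset.mem_image, Finset.mem_product, Prod.exists, mem_isos]
  constructor
  · rintro (⟨f, g, hf, hg, rfl⟩ | ⟨f, g, hf, hg, rfl⟩)
    · exact Or.inl ⟨f, g, ⟨hf, hg⟩, rfl⟩
    · exact Or.inr ⟨f, g, ⟨hf, hg⟩, rfl⟩
  · rintro (⟨f, g, ⟨hf, hg⟩, rfl⟩ | ⟨f, g, ⟨hf, hg⟩, rfl⟩)
    · exact Or.inl ⟨f, g, hf, hg, rfl⟩
    · exact Or.inr ⟨f, g, hf, hg, rfl⟩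

theorem sum_isos_node_node {M : Type*} [AddCommMonoid M] (l r l' r' : PTree)
    (F : Leaf (node l r) ≃ Leaf (node l' r') → M) :
    ∑ e ∈ isos (node l r) (node l' r'), F e =
      ∑ f ∈ isos l l', ∑ g ∈ isos r r', F (straight f g) +
      ∑ f ∈ isos l r', ∑ g ∈ isos r l', F (crossed f g) := by
  rw [isos_node_node, Finset.sum_union, Finset.sum_image, Finset.sum_image,
    Finset.sum_product, Finset.sum_product]
  · rintro ⟨f, g⟩ _ ⟨f', g'⟩ _ h
    exact Prod.ext_iff.2 (crossed_inj h)
  · rintro ⟨f, g⟩ _ ⟨f', g'⟩ _ h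
    exact Prod.ext_iff.2 (straight_inj h)
  · rw [Finset.disjoint_left]
    intro e he he'
    obtain ⟨p, -, rfl⟩ := Finset.mem_image.1 he
    obtain ⟨q, -, hq⟩ := Finset.mem_image.1 he'
    exact straight_ne_crossed _ _ _ _ hq.symm

theorem isos_eq_empty {T T' : PTree} (h : T.size ≠ T'.size) : isos T T' = ∅ :=
  Finset.eq_empty_of_forall_notMem fun _ he => h (mem_isos.1 he).size_eq

theorem card_isos_node_node (l r l' r' : PTree) :
    (isos (node l r) (node l' r')).card =
      (isos l l').card * (isos r r').card + (isos l r').card * (isos r l').card := by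
  simp only [Finset.card_eq_sum_ones]
  rw [sum_isos_node_node]
  simp

theorem sum_card_isos_of_ne {T : PTree} {n : ℕ} (h : n ≠ T.size) :
    ∑ T' ∈ planeTrees n, (isos T T').card = 0 :=
  Finset.sum_eq_zero fun T' hT' => by
    rw [isos_eq_empty, Finset.card_empty]
    rw [mem_planeTrees.1 hT']
    exact h.symm

theorem two_mul_sum_card_isos (T : PTree) :
    2 * ∑ T' ∈ planeTrees T.size, (isos T T').card = 2 ^ T.size := by
  induction T with
  | leaf =>
    have : (isos leaf leaf).card = 1 := by
      rw [Finset.card_eq_one]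
      refine ⟨Equiv.refl _, ?_⟩
      ext e
      simp only [mem_isos, Finset.mem_singleton]
      exact ⟨fun _ => Equiv.ext fun x => rfl, fun _ => trivial⟩
    simp [size, planeTrees_one, this]
  | node l r hl hr =>
    have hl0 := size_pos l
    have hr0 := size_pos r
    obtain ⟨n, hn⟩ : ∃ n, l.size + r.size = n + 2 := ⟨l.size + r.size - 2, by omega⟩
    simp only [size]
    rw [hn, sum_planeTrees_add_two]
    simp only [card_isos_node_node, Finset.sum_add_distrib]
    have h1 : ∑ p ∈ Finset.HasAntidiagonal.antidiagonal (n + 2), ∑ l' ∈ planeTrees p.1,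
        ∑ r' ∈ planeTrees p.2, (isos l l').card * (isos r r').card =
        (∑ l' ∈ planeTrees l.size, (isos l l').card) *
          ∑ r' ∈ planeTrees r.size, (isos r r').card := by
      simp_rw [← Finset.mul_sum, ← Finset.sum_mul]
      rw [Finset.sum_eq_single (l.size, r.size)]
      · rintro ⟨a, b⟩ hab hne
        have := Finset.HasAntidiagonal.mem_antidiagonal.1 hab
        by_cases ha : a = l.size
        · subst ha
          have hb : b = r.size := by
            dsimp only at this
            exact Nat.add_left_cancel (this.trans hn.symm)
          exact absurd (by rw [hb]) hne
        · simp [sum_card_isos_of_ne ha]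
      · intro h
        exact absurd (Finset.HasAntidiagonal.mem_antidiagonal.2 hn) h
    have h2 : ∑ p ∈ Finset.HasAntidiagonal.antidiagonal (n + 2), ∑ l' ∈ planeTrees p.1,
        ∑ r' ∈ planeTrees p.2, (isos l r').card * (isos r l').card =
        (∑ l' ∈ planeTrees l.size, (isos l l').card) *
          ∑ r' ∈ planeTrees r.size, (isos r r').card := by
      simp_rw [← Finset.sum_mul, ← Finset.mul_sum]
      rw [Finset.sum_eq_single (r.size, l.size)]
      · rintro ⟨a, b⟩ hab hne
        have := Finset.HasAntidiagonal.mem_antidiagonal.1 hab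
        by_cases ha : a = r.size
        · subst ha
          have hb : b = l.size := by dsimp only at this; omega
          exact absurd (by rw [hb]) hne
        · simp [sum_card_isos_of_ne ha]
      · intro h
        exact absurd (Finset.HasAntidiagonal.mem_antidiagonal.2 (by rw [← hn, add_comm])) h
    rw [h1, h2, ← hn, pow_add, ← hl, ← hr]
    ring

/-- The list of values of a matching. -/
noncomputable def matchingList {T S : PTree} (v : Leaf T ≃ Leaf S) : List ℕ :=
  List.ofFn fun i : Fin T.size => pos S (v (exists_pos_eq i.2).choose)

theorem matchingList_getD {T S : PTree} (v : Leaf T ≃ Leaf S) (x : Leaf T) :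
    (matchingList v).getD (pos T x) 0 = pos S (v x) := by
  have h : ∀ (h : ∃ y, pos T y = pos T x), h.choose = x := fun h =>
    pos_injective T h.choose_spec
  rw [matchingList, List.getD_eq_getElem _ _ (by simpa using pos_lt x)]
  simp [h]

theorem matchingList_injective {T S : PTree} :
    Function.Injective (matchingList : (Leaf T ≃ Leaf S) → List ℕ) := by
  intro v w h
  refine Equiv.ext fun x => pos_injective S ?_
  rw [← matchingList_getD, h, matchingList_getD]

theorem matchingList_mem {T S : PTree} {n : ℕ} (hS : S.size = n)
    (v : Leaf T ≃ Leaf S) : matchingList v ∈ (List.range n).permutations.toFinset := by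
  rw [List.mem_toFinset, List.mem_permutations, List.perm_ext_iff_of_nodup]
  · intro a
    simp only [matchingList, List.mem_ofFn, List.mem_range]
    constructor
    · rintro ⟨i, rfl⟩
      rw [← hS]
      exact pos_lt _
    · intro ha
      obtain ⟨y, rfl⟩ := exists_pos_eq (hS.symm ▸ ha)
      refine ⟨⟨pos T (v.symm y), pos_lt _⟩, ?_⟩
      have h : ∀ (h : ∃ z, pos T z = pos T (v.symm y)), h.choose = v.symm y := fun h =>
        pos_injective T h.choose_spec
      simp [h]
  · rw [matchingList, List.nodup_ofFn]
    intro i j h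
    have h' := v.injective (pos_injective S h)
    have hi := (exists_pos_eq i.2).choose_spec
    have hj := (exists_pos_eq j.2).choose_spec
    ext
    rw [← hi, ← hj, h']
  · exact List.nodup_range

theorem card_leaf_equiv {T S : PTree} {n : ℕ} (hT : T.size = n) (hS : S.size = n) :
    Fintype.card (Leaf T ≃ Leaf S) = n.factorial := by
  rw [Fintype.card_equiv (Fintype.equivOfCardEq (by rw [card_leaf, card_leaf, hT, hS])),
    card_leaf, hT]

theorem permutations_eq_image {T S : PTree} {n : ℕ} (hT : T.size = n) (hS : S.size = n) :
    (List.range n).permutations.toFinset =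
      (Finset.univ : Finset (Leaf T ≃ Leaf S)).image matchingList := by
  symm
  refine Finset.eq_of_subset_of_card_le ?_ ?_
  · intro L hL
    obtain ⟨v, -, rfl⟩ := Finset.mem_image.1 hL
    exact matchingList_mem hS v
  · rw [Finset.card_image_of_injective _ matchingList_injective, Finset.card_univ,
      card_leaf_equiv hT hS]
    refine (List.toFinset_card_le _).trans ?_
    rw [List.length_permutations, List.length_range]

theorem sum_triples {M : Type*} [AddCommMonoid M] (n : ℕ) (F : PTree × PTree × List ℕ → M) :
    ∑ t ∈ Triples n, F t = ∑ T ∈ planeTrees n, ∑ S ∈ planeTrees n,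
      ∑ v : Leaf T ≃ Leaf S, F (T, S, matchingList v) := by
  rw [Triples, Finset.sum_product]
  refine Finset.sum_congr rfl fun T hT => ?_
  rw [Finset.sum_product]
  refine Finset.sum_congr rfl fun S hS => ?_
  rw [permutations_eq_image (mem_planeTrees.1 hT) (mem_planeTrees.1 hS), Finset.sum_image]
  exact fun _ _ _ _ h => matchingList_injective h

theorem exists_of_mem_triples {n : ℕ} {T S : PTree} {L : List ℕ} (h : (T, S, L) ∈ Triples n) :
    T.size = n ∧ S.size = n ∧ ∃ v : Leaf T ≃ Leaf S, L = matchingList v := by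
  simp only [Triples, Finset.mem_product] at h
  obtain ⟨hT, hS, hL⟩ := h
  rw [mem_planeTrees] at hT hS
  rw [permutations_eq_image hT hS] at hL
  obtain ⟨v, -, hv⟩ := Finset.mem_image.1 hL
  exact ⟨hT, hS, v, hv.symm⟩

theorem equivTriple_iff {n : ℕ} {T S T' S' : PTree} (hT : T.size = n)
    (v : Leaf T ≃ Leaf S) (v' : Leaf T' ≃ Leaf S') :
    equivTriple n (T, S, matchingList v) (T', S', matchingList v') = true ↔
      ∃ φ ψ, IsIso T T' φ ∧ IsIso S S' ψ ∧ φ.trans v' = v.trans ψ := by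
  simp only [equivTriple, List.any_eq_true, List.all_eq_true, List.mem_range, beq_iff_eq]
  constructor
  · rintro ⟨f, hf, g, hg, h⟩
    obtain ⟨φ, hφ, hφ'⟩ := exists_isIso_of_mem_isoFuns hf
    obtain ⟨ψ, hψ, hψ'⟩ := exists_isIso_of_mem_isoFuns hg
    refine ⟨φ, ψ, hφ, hψ, Equiv.ext fun x => pos_injective _ ?_⟩
    have := h (pos T x) (hT ▸ pos_lt x)
    rw [hφ', matchingList_getD, matchingList_getD, hψ'] at this
    exact this
  · rintro ⟨φ, ψ, hφ, hψ, h⟩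
    obtain ⟨f, hf, hf'⟩ := hφ.exists_mem_isoFuns
    obtain ⟨g, hg, hg'⟩ := hψ.exists_mem_isoFuns
    refine ⟨f, hf, g, hg, fun i hi => ?_⟩
    obtain ⟨x, rfl⟩ := exists_pos_eq (hT.symm ▸ hi)
    rw [hf', matchingList_getD, matchingList_getD, hg']
    exact congrArg (pos S') (DFunLike.congr_fun h x)

/-- The isomorphisms between two matched pairs of trees. -/
noncomputable def tangleIsos {T S T' S' : PTree} (v : Leaf T ≃ Leaf S) (v' : Leaf T' ≃ Leaf S') :
    Finset ((Leaf T ≃ Leaf T') × (Leaf S ≃ Leaf S')) :=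
  (isos T T' ×ˢ isos S S').filter fun p => p.1.trans v' = v.trans p.2

theorem mem_tangleIsos {T S T' S' : PTree} {v : Leaf T ≃ Leaf S} {v' : Leaf T' ≃ Leaf S'}
    {p : (Leaf T ≃ Leaf T') × (Leaf S ≃ Leaf S')} :
    p ∈ tangleIsos v v' ↔ IsIso T T' p.1 ∧ IsIso S S' p.2 ∧ p.1.trans v' = v.trans p.2 := by
  simp [tangleIsos, mem_isos, and_assoc]

theorem card_tangleIsos_eq {T S T' S' : PTree} {v : Leaf T ≃ Leaf S} {v' : Leaf T' ≃ Leaf S'}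
    (h : (tangleIsos v v').Nonempty) : (tangleIsos v v').card = (tangleIsos v' v').card := by
  obtain ⟨⟨φ, ψ⟩, h⟩ := h
  obtain ⟨hφ, hψ, h⟩ := mem_tangleIsos.1 h
  simp only [Equiv.ext_iff, Equiv.trans_apply] at h
  refine Finset.card_bij' (fun p _ => (φ.symm.trans p.1, ψ.symm.trans p.2))
    (fun p _ => (φ.trans p.1, ψ.trans p.2)) ?_ ?_ ?_ ?_
  · rintro ⟨a, b⟩ hab
    obtain ⟨ha, hb, hab⟩ := mem_tangleIsos.1 hab
    refine mem_tangleIsos.2 ⟨hφ.symm.trans ha, hψ.symm.trans hb, ?_⟩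
    refine Equiv.ext fun x => ?_
    have h1 := h (φ.symm x)
    have h2 := DFunLike.congr_fun hab (φ.symm x)
    simp only [Equiv.trans_apply, Equiv.apply_symm_apply] at h1 h2 ⊢
    rw [h1, h2, Equiv.symm_apply_apply]
  · rintro ⟨a, b⟩ hab
    obtain ⟨ha, hb, hab⟩ := mem_tangleIsos.1 hab
    refine mem_tangleIsos.2 ⟨hφ.trans ha, hψ.trans hb, ?_⟩
    refine Equiv.ext fun x => ?_
    have h2 := DFunLike.congr_fun hab (φ x)
    simp only [Equiv.trans_apply] at h2 ⊢
    rw [h2, h]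
  · rintro ⟨a, b⟩ _
    simp [← Equiv.trans_assoc]
  · rintro ⟨a, b⟩ _
    simp [← Equiv.trans_assoc]

theorem sum_card_tangleIsos {n : ℕ} {T S : PTree} (hT : T.size = n) (hS : S.size = n)
    (v : Leaf T ≃ Leaf S) :
    4 * ∑ T' ∈ planeTrees n, ∑ S' ∈ planeTrees n, ∑ v' : Leaf T' ≃ Leaf S',
      (tangleIsos v v').card = 4 ^ n := by
  have h : ∀ T' S' : PTree, ∑ v' : Leaf T' ≃ Leaf S', (tangleIsos v v').card =
      (isos T T').card * (isos S S').card := by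
    intro T' S'
    simp only [tangleIsos, Finset.card_filter]
    rw [Finset.sum_comm, ← Finset.card_product, Finset.card_eq_sum_ones]
    refine Finset.sum_congr rfl fun p _ => ?_
    rw [Finset.sum_eq_single (p.1.symm.trans (v.trans p.2))]
    · simp [← Equiv.trans_assoc]
    · intro v' _ hv'
      rw [if_neg]
      intro h
      exact hv' (by rw [← h]; simp [← Equiv.trans_assoc])
    · simp
  simp_rw [h, ← Finset.mul_sum, ← Finset.sum_mul]
  have h1 := two_mul_sum_card_isos T
  have h2 := two_mul_sum_card_isos S
  rw [hT] at h1
  rw [hS] at h2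
  calc _ = (2 * ∑ T' ∈ planeTrees n, (isos T T').card) *
      (2 * ∑ S' ∈ planeTrees n, (isos S S').card) := by ring
    _ = 4 ^ n := by rw [h1, h2, ← mul_pow]; norm_num

theorem card_classes_mul {τ : Type*} (X : Finset τ) (r : τ → τ → Prop) (I : τ → τ → ℕ) (W : ℕ)
    (hrefl : ∀ t ∈ X, r t t) (hsymm : ∀ t ∈ X, ∀ t' ∈ X, r t t' → r t' t)
    (htrans : ∀ t ∈ X, ∀ t' ∈ X, ∀ t'' ∈ X, r t t' → r t' t'' → r t t'')
    (hW : ∀ t ∈ X, ∑ t' ∈ X, I t t' = W)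
    (h0 : ∀ t ∈ X, ∀ t' ∈ X, ¬ r t t' → I t t' = 0)
    (hI : ∀ t ∈ X, ∀ t' ∈ X, r t t' → I t t' = I t' t')
    (P : τ → Prop) (hP : ∀ t ∈ X, ∀ t' ∈ X, r t t' → P t → P t') :
    ((X.image fun t => X.filter (r t)).filter fun c => ∃ t ∈ c, P t).card * W =
      ∑ t ∈ X, if P t then I t t else 0 := by
  have hmaps : ∀ t ∈ X, X.filter (r t) ∈ X.image fun t => X.filter (r t) :=
    fun t ht => Finset.mem_image_of_mem _ ht
  rw [← Finset.sum_fiberwise_of_maps_to hmaps, Finset.card_filter, Finset.sum_mul]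
  refine Finset.sum_congr rfl fun c hc => ?_
  obtain ⟨t₀, ht₀, rfl⟩ := Finset.mem_image.1 hc
  have hfib : X.filter (fun t => X.filter (r t) = X.filter (r t₀)) = X.filter (r t₀) := by
    ext t
    simp only [Finset.mem_filter, and_congr_right_iff]
    intro ht
    constructor
    · intro h
      have : t ∈ X.filter (r t₀) := h ▸ Finset.mem_filter.2 ⟨ht, hrefl t ht⟩
      exact (Finset.mem_filter.1 this).2
    · intro h
      ext t'
      simp only [Finset.mem_filter, and_congr_right_iff]
      intro ht'
      exact ⟨htrans _ ht₀ _ ht _ ht' h, htrans _ ht _ ht₀ _ ht' (hsymm _ ht₀ _ ht h)⟩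
  rw [hfib]
  by_cases hex : ∃ t ∈ X.filter (r t₀), P t
  · rw [if_pos hex, one_mul]
    obtain ⟨t₁, h₁, hP₁⟩ := hex
    rw [Finset.mem_filter] at h₁
    have hP₀ : P t₀ := hP _ h₁.1 _ ht₀ (hsymm _ ht₀ _ h₁.1 h₁.2) hP₁
    rw [← hW t₀ ht₀, ← Finset.sum_filter_add_sum_filter_not X (r t₀)]
    rw [Finset.sum_eq_zero (s := X.filter fun t => ¬ r t₀ t), add_zero]
    · refine Finset.sum_congr rfl fun t ht => ?_
      rw [Finset.mem_filter] at ht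
      rw [if_pos (hP _ ht₀ _ ht.1 ht.2 hP₀), hI _ ht₀ _ ht.1 ht.2]
    · intro t ht
      rw [Finset.mem_filter] at ht
      exact h0 _ ht₀ _ ht.1 ht.2
  · rw [if_neg hex, zero_mul]
    symm
    refine Finset.sum_eq_zero fun t ht => if_neg fun hPt => hex ⟨t, ht, hPt⟩

/-- The number of isomorphisms between two triples. -/
noncomputable def tripleIsoCount (t t' : PTree × PTree × List ℕ) : ℕ :=
  if h : (∃ v : Leaf t.1 ≃ Leaf t.2.1, t.2.2 = matchingList v) ∧
      ∃ v : Leaf t'.1 ≃ Leaf t'.2.1, t'.2.2 = matchingList v then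
    (tangleIsos h.1.choose h.2.choose).card else 0

theorem tripleIsoCount_eq {T S T' S' : PTree} (v : Leaf T ≃ Leaf S) (v' : Leaf T' ≃ Leaf S') :
    tripleIsoCount (T, S, matchingList v) (T', S', matchingList v') =
      (tangleIsos v v').card := by
  have h : (∃ w : Leaf T ≃ Leaf S, matchingList v = matchingList w) ∧
      ∃ w : Leaf T' ≃ Leaf S', matchingList v' = matchingList w := ⟨⟨v, rfl⟩, ⟨v', rfl⟩⟩
  rw [tripleIsoCount, dif_pos h]
  rw [← matchingList_injective h.1.choose_spec, ← matchingList_injective h.2.choose_spec]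

theorem card_filter_tangleClasses (n : ℕ) (P : PTree × PTree × List ℕ → Prop)
    (hP : ∀ {T S T' S' : PTree} (v : Leaf T ≃ Leaf S) (v' : Leaf T' ≃ Leaf S')
      (φ : Leaf T ≃ Leaf T') (ψ : Leaf S ≃ Leaf S'), IsIso T T' φ → IsIso S S' ψ →
      φ.trans v' = v.trans ψ → P (T, S, matchingList v) → P (T', S', matchingList v')) :
    ((tangleClasses n).filter fun c => ∃ t ∈ c, P t).card * 4 ^ n =
      4 * ∑ T ∈ planeTrees n, ∑ S ∈ planeTrees n, ∑ v : Leaf T ≃ Leaf S,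
        if P (T, S, matchingList v) then (tangleIsos v v).card else 0 := by
  have key := card_classes_mul (Triples n) (fun t t' => equivTriple n t t' = true)
    (fun t t' => 4 * tripleIsoCount t t') (4 ^ n) ?_ ?_ ?_ ?_ ?_ ?_ P ?_
  · rw [sum_triples] at key
    simp only [tripleIsoCount_eq, Finset.mul_sum, mul_ite, mul_zero] at key ⊢
    rw [tangleClasses]
    convert key
  · rintro ⟨T, S, L⟩ ht
    obtain ⟨hT, hS, v, rfl⟩ := exists_of_mem_triples ht
    exact (equivTriple_iff hT v v).2 ⟨_, _, .refl T, .refl S, by simp⟩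
  · rintro ⟨T, S, L⟩ ht ⟨T', S', L'⟩ ht' h
    obtain ⟨hT, hS, v, rfl⟩ := exists_of_mem_triples ht
    obtain ⟨hT', hS', v', rfl⟩ := exists_of_mem_triples ht'
    obtain ⟨φ, ψ, hφ, hψ, h⟩ := (equivTriple_iff hT v v').1 h
    refine (equivTriple_iff hT' v' v).2 ⟨_, _, hφ.symm, hψ.symm, Equiv.ext fun x => ?_⟩
    have := DFunLike.congr_fun h (φ.symm x)
    simp only [Equiv.trans_apply, Equiv.apply_symm_apply] at this ⊢
    rw [this, Equiv.symm_apply_apply]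
  · rintro ⟨T, S, L⟩ ht ⟨T', S', L'⟩ ht' ⟨T'', S'', L''⟩ ht'' h h'
    obtain ⟨hT, hS, v, rfl⟩ := exists_of_mem_triples ht
    obtain ⟨hT', hS', v', rfl⟩ := exists_of_mem_triples ht'
    obtain ⟨hT'', hS'', v'', rfl⟩ := exists_of_mem_triples ht''
    obtain ⟨φ, ψ, hφ, hψ, h⟩ := (equivTriple_iff hT v v').1 h
    obtain ⟨φ', ψ', hφ', hψ', h'⟩ := (equivTriple_iff hT' v' v'').1 h'
    refine (equivTriple_iff hT v v'').2 ⟨_, _, hφ.trans hφ', hψ.trans hψ', ?_⟩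
    rw [Equiv.trans_assoc, h', ← Equiv.trans_assoc, h, Equiv.trans_assoc]
  · rintro ⟨T, S, L⟩ ht
    obtain ⟨hT, hS, v, rfl⟩ := exists_of_mem_triples ht
    rw [sum_triples, ← sum_card_tangleIsos hT hS v]
    simp only [tripleIsoCount_eq, Finset.mul_sum]
  · rintro ⟨T, S, L⟩ ht ⟨T', S', L'⟩ ht' h
    obtain ⟨hT, hS, v, rfl⟩ := exists_of_mem_triples ht
    obtain ⟨hT', hS', v', rfl⟩ := exists_of_mem_triples ht'
    rw [tripleIsoCount_eq]
    rw [Finset.card_eq_zero.2, mul_zero]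
    rw [Finset.eq_empty_iff_forall_notMem]
    intro p hp
    obtain ⟨h1, h2, h3⟩ := mem_tangleIsos.1 hp
    exact h ((equivTriple_iff hT v v').2 ⟨_, _, h1, h2, h3⟩)
  · rintro ⟨T, S, L⟩ ht ⟨T', S', L'⟩ ht' h
    obtain ⟨hT, hS, v, rfl⟩ := exists_of_mem_triples ht
    obtain ⟨hT', hS', v', rfl⟩ := exists_of_mem_triples ht'
    obtain ⟨φ, ψ, hφ, hψ, h⟩ := (equivTriple_iff hT v v').1 h
    rw [tripleIsoCount_eq, tripleIsoCount_eq,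
      card_tangleIsos_eq ⟨(φ, ψ), mem_tangleIsos.2 ⟨hφ, hψ, h⟩⟩]
  · rintro ⟨T, S, L⟩ ht ⟨T', S', L'⟩ ht' h
    obtain ⟨hT, hS, v, rfl⟩ := exists_of_mem_triples ht
    obtain ⟨hT', hS', v', rfl⟩ := exists_of_mem_triples ht'
    obtain ⟨φ, ψ, hφ, hψ, h⟩ := (equivTriple_iff hT v v').1 h
    exact hP v v' φ ψ hφ hψ h

end PTree

namespace PTree

section Perm

open Equiv Equiv.Perm

variable {α β : Type*} [Fintype α] [Fintype β]

/-- The bijections intertwining two permutations. -/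
noncomputable def intertwiners (a : Perm α) (b : Perm β) : Finset (α ≃ β) :=
  Finset.univ.filter fun v => a.trans v = v.trans b

theorem mem_intertwiners {a : Perm α} {b : Perm β} {v : α ≃ β} :
    v ∈ intertwiners a b ↔ a.trans v = v.trans b := by simp [intertwiners]

theorem card_intertwiners_of_mem {a : Perm α} {b : Perm β} {v₀ : α ≃ β}
    (h₀ : v₀ ∈ intertwiners a b) :
    (intertwiners a b).card = Nat.card (Subgroup.centralizer {a}) := by
  rw [mem_intertwiners] at h₀
  have h₀' : ∀ x, v₀ (a x) = b (v₀ x) := fun x => Equiv.congr_fun h₀ x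
  have h₁ : ∀ y, v₀.symm (b y) = a (v₀.symm y) := fun y => by
    rw [Equiv.symm_apply_eq, h₀', Equiv.apply_symm_apply]
  rw [← Nat.card_eq_finsetCard]
  refine Nat.card_congr ⟨fun v => ⟨v.1.trans v₀.symm, ?_⟩, fun g => ⟨g.1.trans v₀, ?_⟩, ?_, ?_⟩
  · have hv : ∀ x, v.1 (a x) = b (v.1 x) :=
      fun x => Equiv.congr_fun (mem_intertwiners.1 v.2) x
    rw [Subgroup.mem_centralizer_singleton_iff]
    ext x
    simp [hv, h₁]
  · have hg := Subgroup.mem_centralizer_singleton_iff.1 g.2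
    have hg' : ∀ x, g.1 (a x) = a (g.1 x) := fun x => by
      simpa using congrArg (fun p : Perm α => p x) hg
    refine mem_intertwiners.2 ?_
    ext x
    simp [hg', h₀']
  · intro v; ext x; simp
  · intro g; ext x; simp

theorem card_support_eq_of_mem_intertwiners {a : Perm α} {b : Perm β} {v : α ≃ β}
    (h : v ∈ intertwiners a b) : a.support.card = b.support.card := by
  have hv : ∀ x, v (a x) = b (v x) := fun x => Equiv.congr_fun (mem_intertwiners.1 h) x
  refine Finset.card_bij (fun x _ => v x) ?_ (fun _ _ _ _ h => v.injective h) ?_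
  · intro x hx
    rw [mem_support] at hx ⊢
    rwa [← hv, v.injective.ne_iff]
  · intro y hy
    refine ⟨v.symm y, ?_, by simp⟩
    rw [mem_support] at hy ⊢
    intro h
    apply hy
    conv_lhs => rw [← v.apply_symm_apply y, ← hv, h]
    simp

theorem prod_factorial_count_le (c : Multiset ℕ) :
    ∏ n ∈ c.toFinset, (c.count n).factorial ≤ c.card.factorial := by
  refine Nat.le_of_dvd (Nat.factorial_pos _) ?_
  have := Nat.prod_factorial_dvd_factorial_sum c.toFinset fun n => c.count n
  rwa [Multiset.toFinset_sum_count_eq] at this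

theorem prod_mul_factorial_card_le (c : Multiset ℕ) :
    (∀ n ∈ c, Even n ∧ 2 ≤ n) →
    2 * c.card ≤ c.sum ∧ ∃ s, c.sum = 2 * s ∧ c.prod * c.card.factorial ≤ 2 ^ s * s.factorial := by
  induction c using Multiset.induction with
  | empty => intro _; exact ⟨by simp, 0, by simp⟩
  | cons p c ih =>
    intro h
    obtain ⟨hc, s, hs, hle⟩ := ih fun n hn => h n (Multiset.mem_cons_of_mem hn)
    obtain ⟨⟨q, rfl⟩, hq⟩ := h p (Multiset.mem_cons_self _ _)
    refine ⟨by simp; omega, q + s, by simp; omega, ?_⟩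
    have hq1 : 1 ≤ q := by omega
    have h2q : q + q ≤ 2 ^ q := by
      clear h hq
      induction q, hq1 using Nat.le_induction with
      | base => norm_num
      | succ q hq ih => rw [pow_succ]; omega
    have hf : (s + 1).factorial ≤ (q + s).factorial := Nat.factorial_le (by omega)
    rw [Multiset.prod_cons, Multiset.card_cons, Nat.factorial_succ]
    calc (q + q) * c.prod * ((c.card + 1) * c.card.factorial)
        = (q + q) * (c.card + 1) * (c.prod * c.card.factorial) := by ring
      _ ≤ 2 ^ q * (s + 1) * (2 ^ s * s.factorial) := by gcongr; omega
      _ = 2 ^ (q + s) * (s + 1).factorial := by rw [Nat.factorial_succ]; ring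
      _ ≤ _ := by gcongr

theorem card_intertwiners_le {a : Perm α} (ha : ∀ n ∈ a.cycleType, Even n) {s : ℕ}
    (hs : a.support.card = 2 * s) (b : Perm β) :
    (intertwiners a b).card ≤
      2 ^ s * s.factorial * (Fintype.card α - 2 * s).factorial := by
  rcases (intertwiners a b).eq_empty_or_nonempty with h | ⟨v₀, h₀⟩
  · simp [h]
  rw [card_intertwiners_of_mem h₀, nat_card_centralizer]
  obtain ⟨-, s', hs', hle⟩ := prod_mul_factorial_card_le a.cycleType
    fun n hn => ⟨ha n hn, two_le_of_mem_cycleType hn⟩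
  rw [sum_cycleType] at hs'
  obtain rfl : s = s' := by omega
  rw [sum_cycleType, hs, mul_assoc, mul_comm]
  exact Nat.mul_le_mul_right _ ((Nat.mul_le_mul_left _ (prod_factorial_count_le _)).trans hle)

theorem cycleType_of_involutive {a : Perm α} (ha : Function.Involutive a) {s : ℕ}
    (hs : a.support.card = 2 * s) : a.cycleType = Multiset.replicate s 2 := by
  have h : a ^ 2 = 1 := by ext x; simp [pow_two, ha x]
  have h2 : ∀ n ∈ a.cycleType, n = 2 := fun n hn =>
    pow_prime_eq_one_iff.1 h n hn
  have hr := Multiset.eq_replicate_card.2 h2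
  have := sum_cycleType a
  rw [hr, hs] at this
  simp only [Multiset.sum_replicate, smul_eq_mul] at this
  rw [hr, show a.cycleType.card = s by omega]

theorem card_intertwiners_of_involutive {a : Perm α} (ha : Function.Involutive a) {b : Perm β}
    (hb : Function.Involutive b) (hαβ : Fintype.card α = Fintype.card β) {s : ℕ}
    (hs : a.support.card = 2 * s) (hs' : b.support.card = 2 * s) :
    (intertwiners a b).card =
      2 ^ s * s.factorial * (Fintype.card α - 2 * s).factorial := by
  have e : α ≃ β := Fintype.equivOfCardEq hαβ
  set b' : Perm α := e.symm.permCongr b with hb'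
  have heb : e ∈ intertwiners b' b := mem_intertwiners.2 (by ext x; simp [hb'])
  have hinv : Function.Involutive b' := fun x => by simp [hb', hb _]
  have hb's : b'.support.card = 2 * s := by
    rw [card_support_eq_of_mem_intertwiners heb, hs']
  have hconj : IsConj a b' := by
    rw [isConj_iff_cycleType_eq, cycleType_of_involutive ha hs, cycleType_of_involutive hinv hb's]
  obtain ⟨c, hc⟩ := isConj_iff.1 hconj
  have hmem : c.trans e ∈ intertwiners a b := by
    refine mem_intertwiners.2 ?_
    ext x
    have h1 : b' (c x) = c (a x) := by rw [← hc]; simp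
    have h2 : e (b' (c x)) = b (e (c x)) := Equiv.congr_fun (mem_intertwiners.1 heb) (c x)
    simp [← h1, h2]
  have hsup := sum_cycleType a
  rw [card_intertwiners_of_mem hmem, nat_card_centralizer, hsup, hs,
    cycleType_of_involutive ha hs]
  rcases Nat.eq_zero_or_pos s with rfl | hs0
  · simp
  · rw [Multiset.toFinset_replicate, if_neg hs0.ne']
    simp
    ring

end Perm

end PTree

namespace PTree

section Flip

open Equiv Equiv.Perm

variable {α β : Type*}

/-- `L` contains exactly one point of every orbit of size two of the involution `m`. -/
structure IsTransversal (m : α → α) (L : Finset α) : Prop where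
  involutive : Function.Involutive m
  notMem : ∀ x ∈ L, m x ∉ L
  mem_or_mem : ∀ x, m x ≠ x → x ∈ L ∨ m x ∈ L

theorem IsTransversal.ne {m : α → α} {L : Finset α} (h : IsTransversal m L) {x : α}
    (hx : x ∈ L) : m x ≠ x := fun hm => h.notMem x hx (by rwa [hm])

/-- The map exchanging `x` and `m x` for all `x ∈ A`. -/
noncomputable def flip (m : α → α) (A : Finset α) (x : α) : α :=
  if x ∈ A ∨ m x ∈ A then m x else x

theorem flip_involutive {m : α → α} (hm : Function.Involutive m) (A : Finset α) :
    Function.Involutive (flip m A) := by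
  intro x
  by_cases h : x ∈ A ∨ m x ∈ A
  · have h' : m x ∈ A ∨ m (m x) ∈ A := by rw [hm x]; exact h.symm
    rw [flip, flip, if_pos h, if_pos h', hm x]
  · rw [flip, flip, if_neg h, if_neg h]

/-- The map `flip m A` as a permutation. -/
noncomputable def flipPerm {m : α → α} (hm : Function.Involutive m) (A : Finset α) : Perm α :=
  (flip_involutive hm A).toPerm

theorem flipPerm_apply {m : α → α} (hm : Function.Involutive m) (A : Finset α) (x : α) :
    flipPerm hm A x = flip m A x := rfl

theorem flip_ne_iff {m : α → α} {L : Finset α} (h : IsTransversal m L) {A : Finset α}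
    (hA : A ⊆ L) {x : α} : flip m A x ≠ x ↔ x ∈ A ∨ m x ∈ A := by
  unfold flip
  split_ifs with hx
  · refine iff_of_true ?_ hx
    rcases hx with hx | hx
    · exact h.ne (hA hx)
    · have := h.ne (hA hx)
      rw [h.involutive x] at this
      exact this.symm
  · simpa using hx

theorem filter_flip_ne {m : α → α} {L : Finset α} (h : IsTransversal m L) {A : Finset α}
    (hA : A ⊆ L) : (L.filter fun x => flip m A x ≠ x) = A := by
  ext x
  rw [Finset.mem_filter, flip_ne_iff h hA]
  constructor
  · rintro ⟨hx, hx' | hx'⟩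
    · exact hx'
    · exact absurd (hA hx') (h.notMem x hx)
  · exact fun hx => ⟨hA hx, Or.inl hx⟩

variable [Fintype α] [Fintype β]

theorem card_support_flipPerm {m : α → α} {L : Finset α} (h : IsTransversal m L) {A : Finset α}
    (hA : A ⊆ L) : (flipPerm h.involutive A).support.card = 2 * A.card := by
  have : (flipPerm h.involutive A).support = A ∪ A.image m := by
    ext x
    rw [mem_support, flipPerm_apply, flip_ne_iff h hA, Finset.mem_union, Finset.mem_image]
    refine or_congr_right ⟨fun hx => ⟨_, hx, h.involutive x⟩, ?_⟩
    rintro ⟨y, hy, rfl⟩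
    rwa [h.involutive y]
  rw [this, Finset.card_union_of_disjoint, Finset.card_image_of_injective _ h.involutive.injective,
    two_mul]
  rw [Finset.disjoint_left]
  intro x hx hx'
  obtain ⟨y, hy, rfl⟩ := Finset.mem_image.1 hx'
  exact h.notMem y (hA hy) (hA hx)

/-- The elements of `L` whose orbit under `m` is mapped by `v` to an orbit of `m'`. -/
noncomputable def matched (m : α → α) (m' : β → β) (L : Finset α) (v : α ≃ β) : Finset α :=
  L.filter fun x => m' (v x) = v (m x)

theorem subset_matched {m : α → α} {m' : β → β} {L : Finset α} (h : IsTransversal m L)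
    (hm' : Function.Involutive m') {v : α ≃ β} {A : Finset α} (hA : A ⊆ L) {B : Finset β}
    (hv : v ∈ intertwiners (flipPerm h.involutive A) (flipPerm hm' B)) :
    A ⊆ matched m m' L v := by
  intro x hx
  refine Finset.mem_filter.2 ⟨hA hx, ?_⟩
  have hvx : v (flip m A x) = flip m' B (v x) := Equiv.congr_fun (mem_intertwiners.1 hv) x
  have hne := h.ne (hA hx)
  rw [flip, if_pos (Or.inl hx)] at hvx
  unfold flip at hvx
  split_ifs at hvx
  · exact hvx.symm
  · exact absurd (v.injective hvx) hne

/-- The set of orbits corresponding to `A` under `v`. -/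
noncomputable def transport (m : α → α) (L' : Finset β) (v : α ≃ β) (A : Finset α) : Finset β :=
  L'.filter fun y => flip m A (v.symm y) ≠ v.symm y

theorem mem_intertwiners_transport {m : α → α} {m' : β → β} {L : Finset α} {L' : Finset β}
    (h : IsTransversal m L) (h' : IsTransversal m' L') {v : α ≃ β} {A : Finset α}
    (hA : A ⊆ matched m m' L v) :
    v ∈ intertwiners (flipPerm h.involutive A)
      (flipPerm h'.involutive (transport m L' v A)) := by
  have hAL : A ⊆ L := hA.trans (Finset.filter_subset _ _)
  have key : ∀ x, x ∈ A ∨ m x ∈ A → m' (v x) = v (m x) := by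
    rintro x (hx | hx)
    · exact (Finset.mem_filter.1 (hA hx)).2
    · have := (Finset.mem_filter.1 (hA hx)).2
      rw [h.involutive x] at this
      rw [← this, h'.involutive]
  refine mem_intertwiners.2 (Equiv.ext fun x => ?_)
  change v (flip m A x) = flip m' (transport m L' v A) (v x)
  by_cases hx : x ∈ A ∨ m x ∈ A
  · have hne : m x ≠ x := by
      have := (flip_ne_iff h hAL).2 hx
      rwa [flip, if_pos hx] at this
    have hne' : m' (v x) ≠ v x := by rw [key x hx]; exact v.injective.ne hne
    rw [flip, if_pos hx, flip, if_pos, key x hx]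
    rcases h'.mem_or_mem _ hne' with hL | hL
    · refine Or.inl (Finset.mem_filter.2 ⟨hL, ?_⟩)
      rw [v.symm_apply_apply]
      exact (flip_ne_iff h hAL).2 hx
    · refine Or.inr (Finset.mem_filter.2 ⟨hL, ?_⟩)
      rw [key x hx, v.symm_apply_apply]
      refine (flip_ne_iff h hAL).2 ?_
      rw [h.involutive x]
      exact hx.symm
  · rw [flip, if_neg hx, flip, if_neg]
    rintro (hB | hB)
    · have := (Finset.mem_filter.1 hB).2
      rw [v.symm_apply_apply] at this
      exact hx ((flip_ne_iff h hAL).1 this)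
    · have hz := (flip_ne_iff h hAL).1 (Finset.mem_filter.1 hB).2
      have hz' := key _ hz
      rw [v.apply_symm_apply, h'.involutive] at hz'
      have hxz := v.injective hz'
      rw [hxz] at hx
      rw [h.involutive] at hx
      exact hx hz.symm

theorem eq_transport {m : α → α} {m' : β → β} {L' : Finset β}
    (hm : Function.Involutive m) (h' : IsTransversal m' L') {v : α ≃ β} {A : Finset α}
    {B : Finset β} (hB : B ⊆ L')
    (hv : v ∈ intertwiners (flipPerm hm A) (flipPerm h'.involutive B)) :
    B = transport m L' v A := by
  rw [← filter_flip_ne h' hB]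
  refine Finset.filter_congr fun y _ => ?_
  have hvx : v (flip m A (v.symm y)) = flip m' B (v (v.symm y)) :=
    Equiv.congr_fun (mem_intertwiners.1 hv) (v.symm y)
  rw [v.apply_symm_apply] at hvx
  rw [← hvx, Ne, Ne, Equiv.eq_symm_apply]

theorem card_filter_intertwiners {m : α → α} {m' : β → β} {L : Finset α} {L' : Finset β}
    (h : IsTransversal m L) (h' : IsTransversal m' L') (v : α ≃ β) {s : ℕ} {A : Finset α}
    (hA : A ∈ L.powersetCard s) :
    ((L'.powersetCard s).filter fun B =>
      v ∈ intertwiners (flipPerm h.involutive A) (flipPerm h'.involutive B)).card =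
      if A ⊆ matched m m' L v then 1 else 0 := by
  obtain ⟨hAL, hAs⟩ := Finset.mem_powersetCard.1 hA
  split_ifs with hM
  · rw [Finset.card_eq_one]
    refine ⟨transport m L' v A, ?_⟩
    ext B
    rw [Finset.mem_filter, Finset.mem_powersetCard, Finset.mem_singleton]
    constructor
    · rintro ⟨⟨hB, -⟩, hv⟩
      exact eq_transport h.involutive h' hB hv
    · rintro rfl
      have hsub : transport m L' v A ⊆ L' := Finset.filter_subset _ _
      have hv := mem_intertwiners_transport h h' hM
      refine ⟨⟨hsub, ?_⟩, hv⟩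
      have := card_support_eq_of_mem_intertwiners hv
      rw [card_support_flipPerm h hAL, card_support_flipPerm h' hsub] at this
      omega
  · rw [Finset.card_eq_zero, Finset.filter_eq_empty_iff]
    exact fun B _ hv => hM (subset_matched h h'.involutive hAL hv)

theorem sum_choose_card_matched {m : α → α} {m' : β → β} {L : Finset α} {L' : Finset β}
    (h : IsTransversal m L) (h' : IsTransversal m' L') (hαβ : Fintype.card α = Fintype.card β)
    (s : ℕ) :
    ∑ v : α ≃ β, (matched m m' L v).card.choose s =
      L.card.choose s * L'.card.choose s *
        (2 ^ s * s.factorial * (Fintype.card α - 2 * s).factorial) := by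
  have h1 : ∀ v : α ≃ β, (matched m m' L v).card.choose s =
      ∑ A ∈ L.powersetCard s, ∑ B ∈ L'.powersetCard s,
        if v ∈ intertwiners (flipPerm h.involutive A) (flipPerm h'.involutive B) then 1 else 0 := by
    intro v
    rw [← Finset.card_powersetCard]
    simp_rw [← Finset.card_filter]
    rw [Finset.sum_congr rfl fun A hA => card_filter_intertwiners h h' v hA, ← Finset.card_filter]
    congr 1
    ext A
    simp only [Finset.mem_powersetCard, Finset.mem_filter]
    have : matched m m' L v ⊆ L := Finset.filter_subset _ _
    exact ⟨fun hA => ⟨⟨hA.1.trans this, hA.2⟩, hA.1⟩, fun hA => ⟨hA.2, hA.1.2⟩⟩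
  simp_rw [h1]
  rw [Finset.sum_comm]
  simp_rw [Finset.sum_comm (s := Finset.univ)]
  rw [← Finset.card_powersetCard s L, ← Finset.card_powersetCard s L', mul_assoc,
    ← smul_eq_mul, ← Finset.sum_const]
  refine Finset.sum_congr rfl fun A hA => ?_
  rw [← smul_eq_mul, ← Finset.sum_const]
  refine Finset.sum_congr rfl fun B hB => ?_
  obtain ⟨hAL, hAs⟩ := Finset.mem_powersetCard.1 hA
  obtain ⟨hBL, hBs⟩ := Finset.mem_powersetCard.1 hB
  rw [Finset.sum_boole, Finset.filter_univ_mem, Nat.cast_id]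
  exact card_intertwiners_of_involutive (flip_involutive h.involutive A)
    (flip_involutive h'.involutive B) hαβ
    (by rw [card_support_flipPerm h hAL, hAs]) (by rw [card_support_flipPerm h' hBL, hBs])

end Flip

end PTree

namespace PTree

/-- The involution exchanging the two leaves of every cherry. -/
def mate : (T : PTree) → Leaf T → Leaf T
  | leaf => id
  | node leaf leaf => Sum.swap
  | node l r => Sum.map (mate l) (mate r)

theorem node_cases (l r : PTree) : (l = leaf ∧ r = leaf) ∨
    (¬ (l = leaf ∧ r = leaf) ∧ mate (node l r) = Sum.map (mate l) (mate r) ∧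
      ∀ k, cherryList (node l r) k = cherryList l k ++ cherryList r (k + l.size)) := by
  by_cases h : l = leaf ∧ r = leaf
  · exact Or.inl h
  · refine Or.inr ⟨h, ?_, ?_⟩
    · cases l with
      | leaf => cases r with
        | leaf => exact absurd ⟨rfl, rfl⟩ h
        | node => rfl
      | node => rfl
    · intro k
      rw [cherryList.eq_3]
      rintro rfl rfl
      exact h ⟨rfl, rfl⟩

theorem mate_involutive (T : PTree) : Function.Involutive (mate T) := by
  induction T with
  | leaf => exact fun _ => rfl
  | node l r hl hr =>
    rcases node_cases l r with ⟨rfl, rfl⟩ | ⟨-, h, -⟩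
    · exact Sum.swap_swap
    · rw [h]
      rintro (x | x)
      · exact congrArg Sum.inl (hl x)
      · exact congrArg Sum.inr (hr x)

theorem IsIso.leaf_iff {T T' : PTree} {e : Leaf T ≃ Leaf T'} (h : IsIso T T' e) :
    T = leaf ↔ T' = leaf := by
  cases T <;> cases T' <;> first | exact h.elim | simp

theorem IsIso.apply_mate {T T' : PTree} {e : Leaf T ≃ Leaf T'} (h : IsIso T T' e) (x : Leaf T) :
    e (mate T x) = mate T' (e x) := by
  induction T generalizing T' with
  | leaf => cases T' with
    | leaf => rfl
    | node => exact h.elim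
  | node l r hl hr => cases T' with
    | leaf => exact h.elim
    | node l' r' =>
      rcases h with ⟨f, g, hf, hg, rfl⟩ | ⟨f, g, hf, hg, rfl⟩
      · rcases node_cases l r with ⟨rfl, rfl⟩ | ⟨hn, hm, -⟩
        · obtain rfl := hf.leaf_iff.1 rfl
          obtain rfl := hg.leaf_iff.1 rfl
          rcases x with x | x <;> rfl
        · rw [hf.leaf_iff, hg.leaf_iff] at hn
          have hm' := ((node_cases l' r').resolve_left hn).2.1
          rw [hm, hm']
          rcases x with x | x
          · exact congrArg Sum.inl (hl hf x)
          · exact congrArg Sum.inr (hr hg x)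
      · rcases node_cases l r with ⟨rfl, rfl⟩ | ⟨hn, hm, -⟩
        · obtain rfl := hf.leaf_iff.1 rfl
          obtain rfl := hg.leaf_iff.1 rfl
          rcases x with x | x <;> rfl
        · rw [hf.leaf_iff, hg.leaf_iff, and_comm] at hn
          have hm' := ((node_cases l' r').resolve_left hn).2.1
          rw [hm, hm']
          rcases x with x | x
          · exact congrArg Sum.inr (hl hf x)
          · exact congrArg Sum.inl (hr hg x)

/-- The left leaves of the cherries. -/
noncomputable def cherryLeaves (T : PTree) : Finset (Leaf T) :=
  Finset.univ.filter fun x => pos T x < pos T (mate T x)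

theorem isTransversal_cherryLeaves (T : PTree) : IsTransversal (mate T) (cherryLeaves T) where
  involutive := mate_involutive T
  notMem x hx := by
    simp only [cherryLeaves, Finset.mem_filter, Finset.mem_univ, true_and, mate_involutive T x]
      at hx ⊢
    omega
  mem_or_mem x hx := by
    simp only [cherryLeaves, Finset.mem_filter, Finset.mem_univ, true_and, mate_involutive T x]
    exact lt_or_gt_of_ne ((pos_injective T).ne hx.symm)

theorem isIso_flipPerm (T : PTree) (A : Finset (Leaf T)) :
    IsIso T T (flipPerm (mate_involutive T) A) := by
  induction T with
  | leaf => trivial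
  | node l r hl hr =>
    rcases node_cases l r with ⟨rfl, rfl⟩ | ⟨hn, hm, -⟩
    · by_cases hA : (Sum.inl () : Leaf (node leaf leaf)) ∈ A ∨
          (Sum.inr () : Leaf (node leaf leaf)) ∈ A
      · refine Or.inr ⟨Equiv.refl _, Equiv.refl _, trivial, trivial, ?_⟩
        ext x
        rw [flipPerm_apply, flip, if_pos]
        · rcases x with x | x <;> rfl
        · rcases x with x | x
          · exact hA
          · exact hA.symm
      · refine Or.inl ⟨Equiv.refl _, Equiv.refl _, trivial, trivial, ?_⟩
        ext x
        rw [flipPerm_apply, flip, if_neg]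
        · rcases x with x | x <;> rfl
        · rcases x with x | x
          · exact hA
          · exact fun h => hA h.symm
    · refine Or.inl ⟨_, _, hl (Finset.univ.filter fun x => (Sum.inl x : Leaf (node l r)) ∈ A),
        hr (Finset.univ.filter fun x => (Sum.inr x : Leaf (node l r)) ∈ A), ?_⟩
      ext x
      rw [flipPerm_apply, flip, hm]
      rcases x with x | x
      · change _ = Sum.inl (flip (mate l) _ x)
        simp only [Sum.map_inl, flip, Finset.mem_filter, Finset.mem_univ, true_and]
        by_cases h : (Sum.inl x : Leaf (node l r)) ∈ A ∨
            (Sum.inl (mate l x) : Leaf (node l r)) ∈ A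
        · exact (if_pos h).trans (congrArg Sum.inl (if_pos h).symm)
        · exact (if_neg h).trans (congrArg Sum.inl (if_neg h).symm)
      · change _ = Sum.inr (flip (mate r) _ x)
        simp only [Sum.map_inr, flip, Finset.mem_filter, Finset.mem_univ, true_and]
        by_cases h : (Sum.inr x : Leaf (node l r)) ∈ A ∨
            (Sum.inr (mate r x) : Leaf (node l r)) ∈ A
        · exact (if_pos h).trans (congrArg Sum.inr (if_pos h).symm)
        · exact (if_neg h).trans (congrArg Sum.inr (if_neg h).symm)

theorem countP_cherryList (T : PTree) (k : ℕ) (p : ℕ × ℕ → Bool) :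
    (cherryList T k).countP p =
      ∑ x, if pos T x < pos T (mate T x) ∧ p (k + pos T x, k + pos T (mate T x)) = true
        then 1 else 0 := by
  induction T generalizing k with
  | leaf =>
    refine (Finset.sum_eq_zero fun x _ => if_neg fun h => lt_irrefl _ h.1).symm
  | node l r hl hr =>
    rcases node_cases l r with ⟨rfl, rfl⟩ | ⟨-, hm, hc⟩
    · refine Eq.trans ?_ (Fintype.sum_sum_type _).symm
      refine Eq.trans ?_ (congrArg₂ (· + ·) (Fintype.sum_unique (ι := Unit) _).symm
        (Fintype.sum_unique (ι := Unit) _).symm)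
      have h1 : pos (node leaf leaf) (mate (node leaf leaf) (Sum.inl PUnit.unit)) = 1 := rfl
      have h2 : pos (node leaf leaf) (mate (node leaf leaf) (Sum.inr PUnit.unit)) = 0 := rfl
      simp [cherryList, h1, h2, pos, size, List.countP_cons]
    · refine Eq.trans ?_ (Fintype.sum_sum_type _).symm
      rw [hc, List.countP_append, hl, hr, hm]
      simp [pos, add_assoc]

theorem matchedCherries_eq {T S : PTree} (v : Leaf T ≃ Leaf S) :
    matchedCherries T S (matchingList v) =
      (matched (mate T) (mate S) (cherryLeaves T) v).card := by
  have hany : ∀ q : ℕ × ℕ → Bool, (cherryList S 0).any q = true ↔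
      ∃ y ∈ cherryLeaves S, q (pos S y, pos S (mate S y)) = true := by
    intro q
    rw [List.any_eq_true, ← List.countP_pos_iff, countP_cherryList, Finset.sum_pos_iff]
    simp only [cherryLeaves, Finset.mem_filter, Finset.mem_univ, true_and, zero_add]
    refine exists_congr fun x => ?_
    split_ifs with h <;> simpa using h
  rw [matchedCherries, countP_cherryList, ← Finset.card_filter, matched, cherryLeaves,
    Finset.filter_filter]
  congr 1
  refine Finset.filter_congr fun x _ => and_congr_right fun hx => ?_
  rw [hany]
  simp only [zero_add, matchingList_getD, Bool.or_eq_true, Bool.and_eq_true, beq_iff_eq,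
    (pos_injective S).eq_iff]
  constructor
  · rintro ⟨y, -, ⟨h1, h2⟩ | ⟨h1, h2⟩⟩
    · rw [h1, h2]
    · rw [h1, h2, mate_involutive S y]
  · intro h
    have hne : mate S (v x) ≠ v x := by
      rw [h, v.injective.ne_iff]
      intro h'
      rw [h'] at hx
      exact lt_irrefl _ hx
    rcases (isTransversal_cherryLeaves S).mem_or_mem _ hne with hL | hL
    · exact ⟨_, hL, Or.inl ⟨rfl, h.symm⟩⟩
    · exact ⟨_, hL, Or.inr ⟨(mate_involutive S _).symm, h.symm⟩⟩

theorem two_mul_card_matched {T S : PTree} (v : Leaf T ≃ Leaf S) :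
    2 * (matched (mate T) (mate S) (cherryLeaves T) v).card =
      (Finset.univ.filter fun x => mate T x ≠ x ∧ mate S (v x) = v (mate T x)).card := by
  have h := isTransversal_cherryLeaves T
  have hm := mate_involutive T
  have : (Finset.univ.filter fun x => mate T x ≠ x ∧ mate S (v x) = v (mate T x)) =
      matched (mate T) (mate S) (cherryLeaves T) v ∪
        (matched (mate T) (mate S) (cherryLeaves T) v).image (mate T) := by
    ext x
    have hx : mate S (v (mate T x)) = v x ↔ mate S (v x) = v (mate T x) := by
      constructor <;> intro h' <;> rw [← h', mate_involutive S]
    simp only [matched, Finset.mem_filter, Finset.mem_univ, true_and, Finset.mem_union,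
      Finset.mem_image]
    constructor
    · rintro ⟨h1, h2⟩
      rcases h.mem_or_mem x h1 with hL | hL
      · exact Or.inl ⟨hL, h2⟩
      · exact Or.inr ⟨_, ⟨hL, by rw [hx.2 h2, hm x]⟩, hm x⟩
    · rintro (⟨hL, h2⟩ | ⟨y, ⟨hL, h2⟩, rfl⟩)
      · exact ⟨h.ne hL, h2⟩
      · rw [hm y]
        exact ⟨(h.ne hL).symm, by rw [← h2, mate_involutive S]⟩
  rw [this, Finset.card_union_of_disjoint, Finset.card_image_of_injective _ hm.injective, two_mul]
  rw [Finset.disjoint_left]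
  intro x hx hx'
  obtain ⟨y, hy, rfl⟩ := Finset.mem_image.1 hx'
  exact h.notMem y (Finset.mem_filter.1 hy).1 (Finset.mem_filter.1 hx).1

theorem matchedCherries_congr {T S T' S' : PTree} (v : Leaf T ≃ Leaf S) (v' : Leaf T' ≃ Leaf S')
    {φ : Leaf T ≃ Leaf T'} {ψ : Leaf S ≃ Leaf S'} (hφ : IsIso T T' φ) (hψ : IsIso S S' ψ)
    (h : φ.trans v' = v.trans ψ) :
    matchedCherries T S (matchingList v) = matchedCherries T' S' (matchingList v') := by
  have h' : ∀ x, v' (φ x) = ψ (v x) := fun x => Equiv.congr_fun h x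
  rw [matchedCherries_eq, matchedCherries_eq]
  refine Nat.eq_of_mul_eq_mul_left two_pos ?_
  rw [two_mul_card_matched, two_mul_card_matched]
  refine Finset.card_equiv φ fun x => ?_
  simp only [Finset.mem_filter, Finset.mem_univ, true_and]
  rw [← hφ.apply_mate, h', h', ← hψ.apply_mate, φ.injective.ne_iff, ψ.injective.eq_iff]

theorem two_pow_card_matched_le {T S : PTree} (v : Leaf T ≃ Leaf S) :
    2 ^ (matched (mate T) (mate S) (cherryLeaves T) v).card ≤ (tangleIsos v v).card := by
  have hT := isTransversal_cherryLeaves T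
  have hS := isTransversal_cherryLeaves S
  rw [← Finset.card_powerset]
  refine Finset.card_le_card_of_injOn (fun A => (flipPerm hT.involutive A,
    flipPerm hS.involutive (transport (mate T) (cherryLeaves S) v A))) ?_ ?_
  · intro A hA
    rw [Finset.mem_coe, Finset.mem_powerset] at hA
    exact mem_tangleIsos.2 ⟨isIso_flipPerm T A, isIso_flipPerm S _,
      mem_intertwiners.1 (mem_intertwiners_transport hT hS hA)⟩
  · intro A hA B hB hAB
    rw [Finset.mem_coe, Finset.mem_powerset] at hA hB
    have hsub : matched (mate T) (mate S) (cherryLeaves T) v ⊆ cherryLeaves T :=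
      Finset.filter_subset _ _
    have hflip : flip (mate T) A = flip (mate T) B := by
      funext x
      exact Equiv.congr_fun (congrArg Prod.fst hAB) x
    rw [← filter_flip_ne hT (hA.trans hsub), ← filter_flip_ne hT (hB.trans hsub), hflip]

end PTree

namespace PTree

section Series

open PowerSeries

/-- The generating series of plane trees by number of leaves. -/
noncomputable def treeSeries : PowerSeries ℝ := PowerSeries.mk fun n => ((planeTrees n).card : ℝ)

theorem treeSeries_eq : treeSeries = X + treeSeries ^ 2 := by
  have h : treeSeries = X * catalanSeries.map (Nat.castRingHom ℝ) := by
    ext n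
    cases n with
    | zero => simp [treeSeries, planeTrees_zero]
    | succ n => simp [treeSeries, card_planeTrees, coeff_succ_X_mul]
  have hc := congrArg (PowerSeries.map (Nat.castRingHom ℝ)) catalanSeries_sq_mul_X_add_one
  simp only [map_add, map_mul, map_pow, map_one, PowerSeries.map_X] at hc
  rw [h]
  calc _ = X * ((catalanSeries.map (Nat.castRingHom ℝ)) ^ 2 * X + 1) := by rw [hc]
    _ = _ := by ring

theorem eq_of_quadratic {R : Type*} [CommRing R] [IsDomain R] {W Y Z : PowerSeries R}
    (hY : Y = W + Y ^ 2) (hZ : Z = W + Z ^ 2) (hY0 : constantCoeff Y = 0)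
    (hZ0 : constantCoeff Z = 0) : Y = Z := by
  have h : (Y - Z) * (1 - Y - Z) = 0 := by linear_combination hY - hZ
  rcases mul_eq_zero.1 h with h | h
  · exact sub_eq_zero.1 h
  · have := congrArg constantCoeff h
    simp [hY0, hZ0] at this

theorem coeff_subst_treeSeries {R : Type*} [CommRing R] [Algebra ℝ R] {W : PowerSeries R}
    (hW : constantCoeff W = 0) (n : ℕ) :
    coeff n (treeSeries.subst W) =
      ∑ N ∈ Finset.range (n + 1), ((planeTrees N).card : ℝ) • coeff n (W ^ N) := by
  rw [coeff_subst' (HasSubst.of_constantCoeff_zero' hW)]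
  rw [finsum_eq_sum_of_support_subset (s := Finset.range (n + 1))]
  · simp [treeSeries]
  · intro N hN
    rw [Function.mem_support] at hN
    rw [Finset.coe_range, Set.mem_Iio]
    by_contra h
    apply hN
    have : coeff n (W ^ N) = 0 :=
      X_pow_dvd_iff.1 (pow_dvd_pow_of_dvd (X_dvd_iff.2 hW) N) n (by omega)
    rw [this, smul_zero]

theorem coeff_of_recurrence {Z : ℕ → Polynomial ℝ} {D : PowerSeries ℝ}
    (h0 : Z 0 = 0) (h1 : Z 1 = 1) (hD0 : coeff 0 D = 0) (hD1 : coeff 1 D = 0)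
    (hZ : ∀ n, Z (n + 2) = ∑ p ∈ Finset.HasAntidiagonal.antidiagonal (n + 2), Z p.1 * Z p.2 +
      Polynomial.C (coeff (n + 2) D) * Polynomial.X ^ (n + 2)) {m n : ℕ} (hmn : m ≤ n) :
    (Z n).coeff m = ∑ j ∈ Finset.range (m + 1),
      ((planeTrees (n - m + j)).card : ℝ) * (n - m + j).choose j * coeff m (D ^ j) := by
  set D' : PowerSeries (Polynomial ℝ) := rescale Polynomial.X (D.map Polynomial.C) with hD'
  have hDpow : ∀ i j, coeff i (D' ^ j) =
      Polynomial.C (coeff i (D ^ j)) * Polynomial.X ^ i := by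
    intro i j
    rw [hD', ← map_pow, ← map_pow, coeff_rescale, PowerSeries.coeff_map, mul_comm]
  have hDc : ∀ i, coeff i D' = Polynomial.C (coeff i D) * Polynomial.X ^ i := fun i => by
    simpa using hDpow i 1
  have hD0' : constantCoeff D' = 0 := by
    rw [← coeff_zero_eq_constantCoeff_apply, hDc, hD0]; simp
  have hW : constantCoeff (D' + X) = 0 := by simp [hD0']
  have hsub := HasSubst.of_constantCoeff_zero' hW
  have hY : treeSeries.subst (D' + X) = (D' + X) + (treeSeries.subst (D' + X)) ^ 2 := by
    conv_lhs => rw [treeSeries_eq, subst_add hsub, subst_pow hsub, subst_X hsub]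
  have hZs : PowerSeries.mk Z = (D' + X) + (PowerSeries.mk Z) ^ 2 := by
    ext1 i
    rw [pow_two, map_add, map_add, PowerSeries.coeff_mul, hDc]
    match i with
    | 0 => simp [h0, hD0]
    | 1 => simp [h0, h1, hD1, Finset.Nat.antidiagonal_succ]
    | i + 2 => simp [hZ, coeff_X, add_comm]
  have hY0 : constantCoeff (treeSeries.subst (D' + X)) = 0 := by
    rw [← coeff_zero_eq_constantCoeff_apply, coeff_subst_treeSeries hW]
    simp [planeTrees_zero]
  have key := eq_of_quadratic hZs hY (by simp [h0]) hY0
  have key' := congrArg (coeff n) key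
  rw [coeff_mk, coeff_subst_treeSeries hW] at key'
  rw [key', Polynomial.finsetSum_coeff]
  have hterm : ∀ N ∈ Finset.range (n + 1),
      (((planeTrees N).card : ℝ) • coeff n ((D' + X) ^ N)).coeff m =
      ∑ j ∈ Finset.range (m + 1), if N = n - m + j then
        ((planeTrees (n - m + j)).card : ℝ) * (n - m + j).choose j * coeff m (D ^ j) else 0 := by
    intro N hN
    rw [Finset.mem_range] at hN
    rw [Polynomial.coeff_smul, add_pow, map_sum, Polynomial.finsetSum_coeff, smul_eq_mul,
      Finset.mul_sum]
    have hj : ∀ j ∈ Finset.range (N + 1), ((planeTrees N).card : ℝ) *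
        (coeff n (D' ^ j * X ^ (N - j) * ((N.choose j : ℕ) : PowerSeries (Polynomial ℝ)))).coeff m =
        if N = n - m + j then
        ((planeTrees (n - m + j)).card : ℝ) * (n - m + j).choose j * coeff m (D ^ j) else 0 := by
      intro j hj
      rw [Finset.mem_range] at hj
      rw [← map_natCast (PowerSeries.C (R := Polynomial ℝ)), coeff_mul_C, coeff_mul_X_pow',
        ← map_natCast (Polynomial.C (R := ℝ)), Polynomial.coeff_mul_C]
      by_cases h : N = n - m + j
      · rw [if_pos h, if_pos (by omega), hDpow, Polynomial.coeff_C_mul, Polynomial.coeff_X_pow,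
          if_pos (by omega), show n - (N - j) = m by omega, ← h]
        ring
      · rw [if_neg h]
        split_ifs with h'
        · rw [hDpow, Polynomial.coeff_C_mul, Polynomial.coeff_X_pow, if_neg (by omega)]
          ring
        · simp
    rw [Finset.sum_congr rfl hj]
    rw [← Finset.sum_filter, ← Finset.sum_filter]
    refine Finset.sum_congr ?_ fun _ _ => rfl
    ext j
    simp only [Finset.mem_filter, Finset.mem_range]
    omega
  rw [Finset.sum_congr rfl hterm, Finset.sum_comm]
  refine Finset.sum_congr rfl fun j hj => ?_
  rw [Finset.mem_range] at hj
  rw [Finset.sum_ite_eq', if_pos (Finset.mem_range.2 (by omega))]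

end Series

end PTree

namespace PTree

theorem card_cherryLeaves (T : PTree) (k : ℕ) :
    (cherryLeaves T).card = (cherryList T k).length := by
  have := countP_cherryList T k fun _ => true
  rw [List.countP_true] at this
  rw [this, cherryLeaves, Finset.card_filter]
  simp

theorem card_cherryLeaves_node {l r : PTree} (h : l.size + r.size ≠ 2) :
    (cherryLeaves (node l r)).card = (cherryLeaves l).card + (cherryLeaves r).card := by
  rcases node_cases l r with ⟨rfl, rfl⟩ | ⟨-, -, h⟩
  · simp [size] at h
  · rw [card_cherryLeaves _ 0, h, List.length_append, ← card_cherryLeaves, ← card_cherryLeaves]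

theorem card_cherryLeaves_leaf : (cherryLeaves leaf).card = 0 := by
  simp [card_cherryLeaves _ 0, cherryList]

/-- The generating polynomial of sets of cherries in plane trees with `n` leaves. -/
noncomputable def cherryPoly (n : ℕ) : Polynomial ℝ :=
  ∑ T ∈ planeTrees n, (1 + Polynomial.X ^ 2) ^ (cherryLeaves T).card

theorem cherryPoly_add_two (n : ℕ) :
    cherryPoly (n + 2) = ∑ p ∈ Finset.HasAntidiagonal.antidiagonal (n + 2),
      cherryPoly p.1 * cherryPoly p.2 +
      Polynomial.C (PowerSeries.coeff (n + 2) ((PowerSeries.X : PowerSeries ℝ) ^ 2)) *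
        Polynomial.X ^ (n + 2) := by
  rw [cherryPoly, sum_planeTrees_add_two]
  cases n with
  | zero =>
    have h2 : (cherryLeaves (node leaf leaf)).card = 1 := by
      simp [card_cherryLeaves _ 0, cherryList]
    simp [Finset.Nat.antidiagonal_succ, planeTrees_zero, planeTrees_one, h2, cherryPoly,
      card_cherryLeaves_leaf]
  | succ n =>
    rw [PowerSeries.coeff_X_pow, if_neg (by omega), map_zero, zero_mul, add_zero]
    refine Finset.sum_congr rfl fun p hp => ?_
    rw [Finset.HasAntidiagonal.mem_antidiagonal] at hp
    rw [cherryPoly, cherryPoly, Finset.sum_mul_sum]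
    refine Finset.sum_congr rfl fun l hl => Finset.sum_congr rfl fun r hr => ?_
    rw [mem_planeTrees] at hl hr
    rw [card_cherryLeaves_node (by omega), pow_add]

theorem coeff_cherryPoly (n s : ℕ) :
    (cherryPoly n).coeff (2 * s) =
      ∑ T ∈ planeTrees n, (((cherryLeaves T).card.choose s : ℕ) : ℝ) := by
  rw [cherryPoly, Polynomial.finsetSum_coeff]
  refine Finset.sum_congr rfl fun T _ => ?_
  have : ((1 : Polynomial ℝ) + Polynomial.X ^ 2) ^ (cherryLeaves T).card =
      Polynomial.expand ℝ 2 ((1 + Polynomial.X) ^ (cherryLeaves T).card) := by simp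
  rw [this, mul_comm, Polynomial.coeff_expand_mul two_pos, Polynomial.coeff_one_add_X_pow]

theorem sum_choose_card_cherryLeaves {n s : ℕ} (h : 2 * s ≤ n) :
    ∑ T ∈ planeTrees n, (((cherryLeaves T).card.choose s : ℕ) : ℝ) =
      ((planeTrees (n - 2 * s + s)).card : ℝ) * (n - 2 * s + s).choose s := by
  rw [← coeff_cherryPoly, coeff_of_recurrence (Z := cherryPoly) (D := PowerSeries.X ^ 2)
    (by simp [cherryPoly, planeTrees_zero])
    (by simp [cherryPoly, planeTrees_one, card_cherryLeaves_leaf])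
    (by simp) (by simp [PowerSeries.coeff_X_pow]) cherryPoly_add_two h,
    Finset.sum_eq_single_of_mem s (Finset.mem_range.2 (by omega))]
  · rw [← pow_mul, PowerSeries.coeff_X_pow, if_pos rfl, mul_one]
  · intro j _ hj
    rw [← pow_mul, PowerSeries.coeff_X_pow, if_neg (by omega), mul_zero]

/-- The number of leaves moved by a permutation of the leaves. -/
noncomputable def moved {T : PTree} (a : Leaf T ≃ Leaf T) : ℕ :=
  (Equiv.Perm.support a).card

theorem moved_eq_sum {T : PTree} (a : Leaf T ≃ Leaf T) :
    moved a = ∑ x, if a x ≠ x then 1 else 0 := by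
  rw [moved, ← Finset.card_filter]
  rfl

theorem moved_straight {l r : PTree} (f : Leaf l ≃ Leaf l) (g : Leaf r ≃ Leaf r) :
    moved (straight f g) = moved f + moved g := by
  rw [moved_eq_sum, moved_eq_sum, moved_eq_sum]
  refine (Fintype.sum_sum_type _).trans ?_
  congr 1
  · refine Finset.sum_congr rfl fun x _ => if_congr ?_ rfl rfl
    exact Sum.inl_injective.ne_iff
  · refine Finset.sum_congr rfl fun x _ => if_congr ?_ rfl rfl
    exact Sum.inr_injective.ne_iff

theorem moved_crossed {l r : PTree} (f : Leaf l ≃ Leaf r) (g : Leaf r ≃ Leaf l) :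
    moved (crossed f g) = l.size + r.size := by
  rw [moved_eq_sum, Finset.sum_congr rfl fun x _ => if_pos ?_, Finset.sum_const, smul_eq_mul,
    mul_one, Finset.card_univ, card_leaf, size]
  rcases x with x | x
  · exact Sum.inr_ne_inl
  · exact Sum.inl_ne_inr

/-- The generating polynomial of automorphisms of plane trees with `n` leaves. -/
noncomputable def autPoly (n : ℕ) : Polynomial ℝ :=
  ∑ T ∈ planeTrees n, ∑ a ∈ isos T T, Polynomial.X ^ moved a

/-- The generating series of automorphisms exchanging the two branches. -/
noncomputable def crossSeries : PowerSeries ℝ :=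
  PowerSeries.mk fun n => ∑ p ∈ Finset.HasAntidiagonal.antidiagonal n,
    ∑ l ∈ planeTrees p.1, ∑ r ∈ planeTrees p.2, ((isos l r).card : ℝ) * (isos r l).card

theorem autPoly_add_two (n : ℕ) :
    autPoly (n + 2) = ∑ p ∈ Finset.HasAntidiagonal.antidiagonal (n + 2),
      autPoly p.1 * autPoly p.2 +
      Polynomial.C (PowerSeries.coeff (n + 2) crossSeries) * Polynomial.X ^ (n + 2) := by
  rw [autPoly, sum_planeTrees_add_two, crossSeries, PowerSeries.coeff_mk, map_sum,
    Finset.sum_mul, ← Finset.sum_add_distrib]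
  refine Finset.sum_congr rfl fun p hp => ?_
  rw [Finset.HasAntidiagonal.mem_antidiagonal] at hp
  rw [autPoly, autPoly, Finset.sum_mul_sum, map_sum, Finset.sum_mul, ← Finset.sum_add_distrib]
  refine Finset.sum_congr rfl fun l hl => ?_
  rw [map_sum, Finset.sum_mul, ← Finset.sum_add_distrib]
  refine Finset.sum_congr rfl fun r hr => ?_
  rw [mem_planeTrees] at hl hr
  rw [sum_isos_node_node, Finset.sum_mul_sum]
  congr 1
  · simp_rw [moved_straight, pow_add]
  · simp_rw [moved_crossed, hl, hr, hp]
    simp [mul_assoc]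

theorem isos_leaf_leaf : isos leaf leaf = {Equiv.refl _} := by
  ext e
  rw [mem_isos, Finset.mem_singleton]
  exact ⟨fun _ => Equiv.ext fun _ => rfl, fun _ => trivial⟩

theorem coeff_crossSeries_zero : PowerSeries.coeff 0 crossSeries = 0 := by
  simp [crossSeries, planeTrees_zero]

theorem coeff_crossSeries_one : PowerSeries.coeff 1 crossSeries = 0 := by
  simp [crossSeries, planeTrees_zero, Finset.Nat.antidiagonal_succ]

theorem coeff_crossSeries_two : PowerSeries.coeff 2 crossSeries = 1 := by
  simp [crossSeries, planeTrees_zero, planeTrees_one, Finset.Nat.antidiagonal_succ, isos_leaf_leaf]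

theorem autPoly_one : autPoly 1 = 1 := by
  have : moved (Equiv.refl (Leaf leaf)) = 0 := by simp [moved_eq_sum]
  simp [autPoly, planeTrees_one, isos_leaf_leaf, this]

theorem coeff_autPoly {m n : ℕ} (hmn : m ≤ n) :
    (autPoly n).coeff m = ∑ j ∈ Finset.range (m + 1),
      ((planeTrees (n - m + j)).card : ℝ) * (n - m + j).choose j *
        PowerSeries.coeff m (crossSeries ^ j) :=
  coeff_of_recurrence (by simp [autPoly, planeTrees_zero]) autPoly_one
    coeff_crossSeries_zero coeff_crossSeries_one autPoly_add_two hmn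

theorem coeff_autPoly_eq_card (n m : ℕ) :
    (autPoly n).coeff m =
      ((∑ T ∈ planeTrees n, ((isos T T).filter fun a => moved a = m).card : ℕ) : ℝ) := by
  rw [autPoly, Polynomial.finsetSum_coeff, Nat.cast_sum]
  refine Finset.sum_congr rfl fun T _ => ?_
  rw [Polynomial.finsetSum_coeff]
  simp only [Polynomial.coeff_X_pow]
  rw [Finset.sum_boole]
  congr 2
  exact Finset.filter_congr fun a _ => eq_comm

theorem card_planeTrees_le (n : ℕ) : (planeTrees n).card ≤ 4 ^ n := by
  cases n with
  | zero => simp [planeTrees_zero]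
  | succ n =>
    rw [card_planeTrees, catalan_eq_centralBinom_div]
    calc n.centralBinom / (n + 1) ≤ n.centralBinom := Nat.div_le_self _ _
      _ ≤ 2 ^ (2 * n) := Nat.choose_le_two_pow _ _
      _ = 4 ^ n := by rw [pow_mul]; norm_num
      _ ≤ 4 ^ (n + 1) := Nat.pow_le_pow_right (by norm_num) (by omega)

theorem sum_card_isos_mul_le (i j : ℕ) :
    ∑ l ∈ planeTrees i, ∑ r ∈ planeTrees j, (isos l r).card * (isos r l).card ≤ 4 ^ (i + j) := by
  by_cases hij : i = j
  · subst hij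
    have hsum : ∀ l ∈ planeTrees i, ∑ r ∈ planeTrees i, (isos l r).card ≤ 2 ^ i := by
      intro l hl
      have := two_mul_sum_card_isos l
      rw [mem_planeTrees.1 hl] at this
      omega
    calc _ ≤ ∑ l ∈ planeTrees i, ∑ r ∈ planeTrees i, (isos l r).card * 2 ^ i := by
          refine Finset.sum_le_sum fun l hl => Finset.sum_le_sum fun r hr => ?_
          refine Nat.mul_le_mul_left _ (le_trans ?_ (hsum r hr))
          exact Finset.single_le_sum (f := fun l => (isos r l).card) (fun _ _ => Nat.zero_le _) hl
      _ ≤ ∑ l ∈ planeTrees i, 2 ^ i * 2 ^ i := by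
          refine Finset.sum_le_sum fun l hl => ?_
          rw [← Finset.sum_mul]
          exact Nat.mul_le_mul_right _ (hsum l hl)
      _ ≤ 4 ^ i * (2 ^ i * 2 ^ i) := by
          rw [Finset.sum_const, smul_eq_mul]
          exact Nat.mul_le_mul_right _ (card_planeTrees_le i)
      _ = 4 ^ (i + i) := by rw [← mul_pow, ← mul_pow, ← two_mul, pow_mul]; norm_num
  · rw [Finset.sum_eq_zero fun l hl => Finset.sum_eq_zero fun r hr => ?_]
    · exact Nat.zero_le _
    · rw [mem_planeTrees] at hl hr
      simp [isos_eq_empty (show l.size ≠ r.size by omega)]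

theorem coeff_crossSeries_nonneg (n : ℕ) : 0 ≤ PowerSeries.coeff n crossSeries := by
  rw [crossSeries, PowerSeries.coeff_mk]
  positivity

theorem coeff_crossSeries_le (n : ℕ) : PowerSeries.coeff n crossSeries ≤ 8 ^ n := by
  rw [crossSeries, PowerSeries.coeff_mk]
  have h : ∀ p ∈ Finset.HasAntidiagonal.antidiagonal n,
      ∑ l ∈ planeTrees p.1, ∑ r ∈ planeTrees p.2, ((isos l r).card : ℝ) * (isos r l).card
        ≤ 4 ^ n := by
    intro p hp
    rw [Finset.HasAntidiagonal.mem_antidiagonal] at hp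
    rw [← hp]
    exact_mod_cast sum_card_isos_mul_le p.1 p.2
  refine (Finset.sum_le_card_nsmul _ _ _ h).trans ?_
  rw [Finset.Nat.card_antidiagonal, nsmul_eq_mul, show (8 : ℝ) ^ n = 2 ^ n * 4 ^ n by
    rw [← mul_pow]; norm_num]
  gcongr
  exact_mod_cast Nat.lt_two_pow_self

theorem coeff_crossSeries_pow_nonneg (j m : ℕ) : 0 ≤ PowerSeries.coeff m (crossSeries ^ j) := by
  induction j generalizing m with
  | zero =>
    rw [pow_zero, PowerSeries.coeff_one]
    split_ifs <;> norm_num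
  | succ j ih =>
    rw [pow_succ, PowerSeries.coeff_mul]
    exact Finset.sum_nonneg fun p _ => mul_nonneg (ih _) (coeff_crossSeries_nonneg _)

theorem coeff_crossSeries_pow_le (j m : ℕ) :
    PowerSeries.coeff m (crossSeries ^ j) ≤ 16 ^ m := by
  induction j generalizing m with
  | zero =>
    rw [pow_zero, PowerSeries.coeff_one]
    split_ifs with h
    · simp [h]
    · positivity
  | succ j ih =>
    have hgeom : ∀ m : ℕ, ∑ i ∈ Finset.range (m + 1), (if i = 0 then 0 else (1 / 2 : ℝ) ^ i) =
        1 - (1 / 2) ^ m := by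
      intro m
      induction m with
      | zero => simp
      | succ m ih => rw [Finset.sum_range_succ, ih, if_neg (by omega)]; ring
    rw [pow_succ', PowerSeries.coeff_mul]
    calc _ ≤ ∑ p ∈ Finset.HasAntidiagonal.antidiagonal m,
          16 ^ m * (if p.1 = 0 then 0 else (1 / 2 : ℝ) ^ p.1) := by
          refine Finset.sum_le_sum fun p hp => ?_
          rw [Finset.HasAntidiagonal.mem_antidiagonal] at hp
          split_ifs with h0
          · rw [h0, coeff_crossSeries_zero, zero_mul, mul_zero]
          · calc _ ≤ (8 : ℝ) ^ p.1 * 16 ^ p.2 :=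
                  mul_le_mul (coeff_crossSeries_le _) (ih _) (coeff_crossSeries_pow_nonneg _ _)
                    (by positivity)
              _ = _ := by
                  rw [← hp, pow_add, mul_right_comm, ← mul_pow]
                  norm_num
      _ = 16 ^ m * (1 - (1 / 2) ^ m) := by
          rw [← Finset.mul_sum, Finset.Nat.sum_antidiagonal_eq_sum_range_succ_mk, ← hgeom]
      _ ≤ 16 ^ m := by
          have : (0 : ℝ) < (1 / 2) ^ m := by positivity
          have h16 : (0 : ℝ) < 16 ^ m := by positivity
          nlinarith

theorem exists_crossSeries_eq :
    ∃ E : PowerSeries ℝ, crossSeries = PowerSeries.X ^ 2 * E ∧ PowerSeries.constantCoeff E = 1 := by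
  have hdvd : (PowerSeries.X : PowerSeries ℝ) ^ 2 ∣ crossSeries := by
    rw [PowerSeries.X_pow_dvd_iff]
    intro m hm
    interval_cases m
    · exact coeff_crossSeries_zero
    · exact coeff_crossSeries_one
  obtain ⟨E, hE⟩ := hdvd
  refine ⟨E, hE, ?_⟩
  have := coeff_crossSeries_two
  rw [hE] at this
  simpa [PowerSeries.coeff_X_pow_mul'] using this

theorem coeff_crossSeries_pow_eq_zero {s j : ℕ} (h : s < j) :
    PowerSeries.coeff (2 * s) (crossSeries ^ j) = 0 := by
  obtain ⟨E, hE, -⟩ := exists_crossSeries_eq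
  rw [hE, mul_pow, ← pow_mul, PowerSeries.coeff_X_pow_mul', if_neg (by omega)]

theorem coeff_crossSeries_pow_self (s : ℕ) :
    PowerSeries.coeff (2 * s) (crossSeries ^ s) = 1 := by
  obtain ⟨E, hE, h1⟩ := exists_crossSeries_eq
  rw [hE, mul_pow, ← pow_mul, PowerSeries.coeff_X_pow_mul', if_pos le_rfl, Nat.sub_self,
    PowerSeries.coeff_zero_eq_constantCoeff_apply, map_pow, h1, one_pow]

theorem coeff_autPoly_two_mul {n s : ℕ} (h : 2 * s ≤ n) :
    (autPoly n).coeff (2 * s) = ∑ j ∈ Finset.range (s + 1),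
      ((planeTrees (n - 2 * s + j)).card : ℝ) * (n - 2 * s + j).choose j *
        PowerSeries.coeff (2 * s) (crossSeries ^ j) := by
  rw [coeff_autPoly h]
  symm
  refine Finset.sum_subset (Finset.range_subset_range.2 (by omega)) fun j _ hj => ?_
  rw [Finset.mem_range, not_lt] at hj
  rw [coeff_crossSeries_pow_eq_zero (by omega), mul_zero]

end PTree

namespace PTree

theorem straight_mul {l r : PTree} (f f' : Equiv.Perm (Leaf l)) (g g' : Equiv.Perm (Leaf r)) :
    (straight f g : Equiv.Perm (Leaf (node l r))) * straight f' g' =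
      straight (f * f') (g * g') := by
  ext x
  rcases x with x | x <;> rfl

theorem straight_pow {l r : PTree} (f : Equiv.Perm (Leaf l)) (g : Equiv.Perm (Leaf r)) (m : ℕ) :
    (straight f g : Equiv.Perm (Leaf (node l r))) ^ m = straight (f ^ m) (g ^ m) := by
  induction m with
  | zero => ext x; rcases x with x | x <;> rfl
  | succ m ih => rw [pow_succ, ih, straight_mul, pow_succ, pow_succ]

theorem crossed_sq {l r : PTree} (f : Leaf l ≃ Leaf r) (g : Leaf r ≃ Leaf l) :
    (crossed f g : Equiv.Perm (Leaf (node l r))) ^ 2 = straight (f.trans g) (g.trans f) := by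
  rw [pow_two]
  ext x
  rcases x with x | x <;> rfl

theorem straight_one {l r : PTree} :
    (straight (1 : Equiv.Perm (Leaf l)) (1 : Equiv.Perm (Leaf r)) :
      Equiv.Perm (Leaf (node l r))) = 1 := by
  ext x
  rcases x with x | x <;> rfl

theorem pow_two_pow_eq_one {G : Type*} [Monoid G] {a : G} {i j : ℕ} (h : a ^ 2 ^ i = 1)
    (hij : i ≤ j) : a ^ 2 ^ j = 1 := by
  obtain ⟨c, hc⟩ := pow_dvd_pow 2 hij
  rw [hc, pow_mul, h, one_pow]

theorem exists_pow_two_pow_eq_one {T : PTree} {a : Equiv.Perm (Leaf T)} (h : a ∈ isos T T) :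
    ∃ i, a ^ 2 ^ i = 1 := by
  induction T with
  | leaf => exact ⟨0, Equiv.ext fun _ => rfl⟩
  | node l r hl hr =>
    have hstraight : ∀ (f : Equiv.Perm (Leaf l)) (g : Equiv.Perm (Leaf r)), f ∈ isos l l →
        g ∈ isos r r → ∃ i, (straight f g : Equiv.Perm (Leaf (node l r))) ^ 2 ^ i = 1 := by
      intro f g hf hg
      obtain ⟨i, hi⟩ := hl hf
      obtain ⟨j, hj⟩ := hr hg
      refine ⟨max i j, ?_⟩
      rw [straight_pow, pow_two_pow_eq_one hi (le_max_left _ _),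
        pow_two_pow_eq_one hj (le_max_right _ _), straight_one]
    rcases mem_isos.1 h with ⟨f, g, hf, hg, rfl⟩ | ⟨f, g, hf, hg, rfl⟩
    · exact hstraight f g (mem_isos.2 hf) (mem_isos.2 hg)
    · obtain ⟨i, hi⟩ := hstraight (f.trans g) (g.trans f) (mem_isos.2 (hf.trans hg))
        (mem_isos.2 (hg.trans hf))
      have hpow : (crossed f g : Equiv.Perm (Leaf (node l r))) ^ 2 ^ (i + 1) = 1 := by
        rw [pow_succ', pow_mul, crossed_sq, hi]
      exact ⟨i + 1, hpow⟩

theorem even_of_mem_cycleType {T : PTree} {a : Equiv.Perm (Leaf T)} (h : a ∈ isos T T) {n : ℕ}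
    (hn : n ∈ a.cycleType) : Even n := by
  obtain ⟨i, hi⟩ := exists_pow_two_pow_eq_one h
  have hdvd : n ∣ 2 ^ i :=
    (Equiv.Perm.dvd_of_mem_cycleType hn).trans (orderOf_dvd_of_pow_eq_one hi)
  obtain ⟨j, -, rfl⟩ := (Nat.dvd_prime_pow Nat.prime_two).1 hdvd
  have h2 := Equiv.Perm.two_le_of_mem_cycleType hn
  refine Nat.even_pow.2 ⟨even_two, ?_⟩
  rintro rfl
  norm_num at h2

theorem even_moved {T : PTree} {a : Equiv.Perm (Leaf T)} (h : a ∈ isos T T) : Even (moved a) := by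
  rw [moved, ← Equiv.Perm.sum_cycleType, even_iff_two_dvd]
  exact Multiset.dvd_sum fun n hn => (even_of_mem_cycleType h hn).two_dvd

/-- The size of the centralizer of a product of `s` disjoint transpositions in the symmetric
group of degree `n`. -/
def involutionWeight (n s : ℕ) : ℕ := 2 ^ s * s.factorial * (n - 2 * s).factorial

/-- The number of pairs of a plane tree with `n` leaves and an automorphism moving
`m` leaves. -/
noncomputable def autCount (n m : ℕ) : ℕ :=
  ∑ T ∈ planeTrees n, ((isos T T).filter fun a => moved a = m).card

theorem card_intertwiners_le_sum {T S : PTree} {n : ℕ} (hT : T.size = n)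
    {a : Equiv.Perm (Leaf T)} (ha : a ∈ isos T T) (b : Equiv.Perm (Leaf S)) :
    (intertwiners a b).card ≤ ∑ s ∈ Finset.range (n / 2 + 1),
      (if moved a = 2 * s then 1 else 0) * (if moved b = 2 * s then 1 else 0) *
        involutionWeight n s := by
  rcases (intertwiners a b).eq_empty_or_nonempty with h | ⟨v, hv⟩
  · simp [h]
  · have hab : moved a = moved b := card_support_eq_of_mem_intertwiners hv
    obtain ⟨s, hs⟩ := even_iff_two_dvd.1 (even_moved ha)
    have hn : moved a ≤ n := by
      rw [← hT, ← card_leaf]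
      exact Finset.card_le_univ _
    refine le_trans ?_ (Finset.single_le_sum (fun _ _ => Nat.zero_le _)
      (Finset.mem_range.2 (show s < n / 2 + 1 by omega)))
    rw [if_pos hs, if_pos (hab ▸ hs), one_mul, one_mul]
    have := card_intertwiners_le (fun n hn => even_of_mem_cycleType ha hn) hs b
    rwa [card_leaf, hT] at this

theorem sum_card_tangleIsos_self (T S : PTree) :
    ∑ v : Leaf T ≃ Leaf S, (tangleIsos v v).card =
      ∑ a ∈ isos T T, ∑ b ∈ isos S S, (intertwiners a b).card := by
  simp_rw [tangleIsos, intertwiners, Finset.card_filter]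
  rw [Finset.sum_comm, Finset.sum_product]

theorem sum_sum_card_tangleIsos_le (n : ℕ) :
    ∑ T ∈ planeTrees n, ∑ S ∈ planeTrees n, ∑ v : Leaf T ≃ Leaf S, (tangleIsos v v).card ≤
      ∑ s ∈ Finset.range (n / 2 + 1), autCount n (2 * s) ^ 2 * involutionWeight n s := by
  calc _ ≤ ∑ T ∈ planeTrees n, ∑ S ∈ planeTrees n, ∑ a ∈ isos T T, ∑ b ∈ isos S S,
        ∑ s ∈ Finset.range (n / 2 + 1), (if moved a = 2 * s then 1 else 0) *
          (if moved b = 2 * s then 1 else 0) * involutionWeight n s := by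
        refine Finset.sum_le_sum fun T hT => Finset.sum_le_sum fun S _ => ?_
        rw [sum_card_tangleIsos_self]
        exact Finset.sum_le_sum fun a ha => Finset.sum_le_sum fun b _ =>
          card_intertwiners_le_sum (mem_planeTrees.1 hT) ha b
    _ = _ := by
        simp_rw [Finset.sum_comm (t := Finset.range (n / 2 + 1))]
        refine Finset.sum_congr rfl fun s _ => ?_
        simp_rw [← Finset.sum_mul]
        congr 1
        simp_rw [autCount, pow_two, Finset.sum_mul_sum, Finset.card_filter, Finset.sum_mul_sum]

/-- The number of matched cherries of a tanglegram. -/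
noncomputable def matchNum {T S : PTree} (v : Leaf T ≃ Leaf S) : ℕ :=
  (matched (mate T) (mate S) (cherryLeaves T) v).card

theorem sum_choose_matchNum (n s : ℕ) :
    ∑ T ∈ planeTrees n, ∑ S ∈ planeTrees n, ∑ v : Leaf T ≃ Leaf S, (matchNum v).choose s =
      (∑ T ∈ planeTrees n, (cherryLeaves T).card.choose s) ^ 2 * involutionWeight n s := by
  rw [pow_two, Finset.sum_mul_sum, Finset.sum_mul]
  refine Finset.sum_congr rfl fun T hT => ?_
  rw [Finset.sum_mul]
  refine Finset.sum_congr rfl fun S hS => ?_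
  rw [mem_planeTrees] at hT hS
  have := sum_choose_card_matched (isTransversal_cherryLeaves T) (isTransversal_cherryLeaves S)
    (by rw [card_leaf, card_leaf, hT, hS]) s
  rwa [card_leaf, hT] at this

theorem nonempty_of_mem_tangleClasses {n : ℕ} {c : Finset (PTree × PTree × List ℕ)}
    (hc : c ∈ tangleClasses n) : ∃ t, t ∈ c := by
  obtain ⟨⟨T, S, L⟩, ht, rfl⟩ := Finset.mem_image.1 hc
  refine ⟨(T, S, L), Finset.mem_filter.2 ⟨ht, ?_⟩⟩
  simp only [Triples, Finset.mem_product, mem_planeTrees] at ht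
  obtain ⟨hT, hS, hL⟩ := ht
  rw [permutations_eq_image hT hS] at hL
  obtain ⟨v, -, rfl⟩ := Finset.mem_image.1 hL
  exact (equivTriple_iff hT v v).2 ⟨_, _, IsIso.refl T, IsIso.refl S, rfl⟩

theorem numTanglegrams_mul (n : ℕ) :
    numTanglegrams n * 4 ^ n = 4 * ∑ T ∈ planeTrees n, ∑ S ∈ planeTrees n,
      ∑ v : Leaf T ≃ Leaf S, (tangleIsos v v).card := by
  have key := card_filter_tangleClasses n (fun _ => True) (fun _ _ _ _ _ _ _ => id)
  have huniv : ((tangleClasses n).filter fun c => ∃ t ∈ c, True) = tangleClasses n :=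
    Finset.filter_true_of_mem fun c hc => by simpa using nonempty_of_mem_tangleClasses hc
  simp only [if_true] at key
  rw [← key, numTanglegrams]
  congr 2
  convert huniv.symm

theorem card_filter_matchedCherries_mul (n k : ℕ) :
    ((tangleClasses n).filter fun c => ∃ t ∈ c, matchedCherries t.1 t.2.1 t.2.2 = k).card * 4 ^ n =
      4 * ∑ T ∈ planeTrees n, ∑ S ∈ planeTrees n, ∑ v : Leaf T ≃ Leaf S,
        if matchNum v = k then (tangleIsos v v).card else 0 := by
  have key := card_filter_tangleClasses n (fun t => matchedCherries t.1 t.2.1 t.2.2 = k) ?_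
  · simp only [matchedCherries_eq] at key
    convert key
    rfl
  · intro T S T' S' v v' φ ψ hφ hψ h hk
    rw [← hk]
    exact (matchedCherries_congr v v' hφ hψ h).symm

end PTree

namespace PTree

open Filter Topology

theorem card_planeTrees_pos (n : ℕ) : 0 < (planeTrees (n + 1)).card := by
  rw [card_planeTrees]
  refine Nat.pos_of_ne_zero fun h => ?_
  have := succ_mul_catalan_eq_centralBinom n
  rw [h, mul_zero] at this
  exact n.centralBinom_ne_zero this.symm

theorem card_planeTrees_succ_succ (n : ℕ) :
    (n + 2) * (planeTrees (n + 2)).card = 2 * (2 * n + 1) * (planeTrees (n + 1)).card := by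
  rw [card_planeTrees, card_planeTrees]
  have h1 := succ_mul_catalan_eq_centralBinom n
  have h2 := succ_mul_catalan_eq_centralBinom (n + 1)
  have h3 := Nat.succ_mul_centralBinom_succ n
  rw [← h1, ← h2] at h3
  refine Nat.eq_of_mul_eq_mul_left n.succ_pos ?_
  rw [Nat.succ_eq_add_one]
  linarith

theorem monotone_card_planeTrees : Monotone fun n => (planeTrees n).card := by
  refine monotone_nat_of_le_succ fun n => ?_
  match n with
  | 0 => simp [planeTrees_zero]
  | n + 1 =>
    refine Nat.le_of_mul_le_mul_left ?_ (show 0 < n + 2 by omega)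
    rw [card_planeTrees_succ_succ]
    rcases n with _ | n
    · norm_num
    · exact Nat.mul_le_mul_right _ (by omega)

theorem tendsto_card_planeTrees_div_succ :
    Tendsto (fun n : ℕ => ((planeTrees n).card : ℝ) / (planeTrees (n + 1)).card) atTop
      (𝓝 (1 / 4)) := by
  rw [← tendsto_add_atTop_iff_nat 1]
  have h : Tendsto (fun n : ℕ => (1 / 4 : ℝ) + (3 / 8) * (1 / ((n : ℝ) + 1 / 2))) atTop
      (𝓝 (1 / 4 + 3 / 8 * 0)) := by
    refine tendsto_const_nhds.add (Tendsto.const_mul _ ?_)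
    simp_rw [one_div]
    exact tendsto_inv_atTop_zero.comp
      (tendsto_atTop_add_const_right _ _ tendsto_natCast_atTop_atTop)
  rw [mul_zero, add_zero] at h
  refine h.congr fun n => ?_
  have hc : (0 : ℝ) < (planeTrees (n + 2)).card := by exact_mod_cast card_planeTrees_pos (n + 1)
  have hrec : ((n : ℝ) + 2) * (planeTrees (n + 2)).card =
      2 * (2 * n + 1) * (planeTrees (n + 1)).card := by
    exact_mod_cast card_planeTrees_succ_succ n
  rw [eq_div_iff hc.ne']
  have hn : (0 : ℝ) < n + 1 / 2 := by positivity
  field_simp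
  linarith

theorem tendsto_card_planeTrees_sub_div (d : ℕ) :
    Tendsto (fun n : ℕ => ((planeTrees (n - d)).card : ℝ) / (planeTrees n).card) atTop
      (𝓝 ((1 / 4) ^ d)) := by
  rw [← tendsto_add_atTop_iff_nat d]
  simp_rw [Nat.add_sub_cancel]
  rw [← tendsto_add_atTop_iff_nat 1]
  induction d with
  | zero =>
    refine tendsto_const_nhds.congr fun n => ?_
    have : (0 : ℝ) < (planeTrees (n + 1)).card := by exact_mod_cast card_planeTrees_pos n
    simp [this.ne']
  | succ d ih =>
    have := ih.mul (tendsto_card_planeTrees_div_succ.comp (tendsto_add_atTop_nat (1 + d)))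
    rw [pow_succ]
    refine this.congr fun n => ?_
    have h1 : (0 : ℝ) < (planeTrees (n + 1 + d)).card := by
      rw [add_right_comm]; exact_mod_cast card_planeTrees_pos (n + d)
    simp only [Function.comp_apply, ← add_assoc]
    rw [div_mul_div_cancel₀ h1.ne']

theorem tendsto_choose_sub_div_pow (d j : ℕ) :
    Tendsto (fun n : ℕ => (((n - d).choose j : ℕ) : ℝ) / (n : ℝ) ^ j) atTop
      (𝓝 (1 / j.factorial)) := by
  have h1 : Tendsto (fun n : ℕ => ((n.choose j : ℕ) : ℝ) / (n : ℝ) ^ j) atTop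
      (𝓝 (1 / j.factorial)) := by
    have h := (Asymptotics.isEquivalent_iff_tendsto_one ?_).1 (isEquivalent_choose j)
    · have := h.mul_const (1 / (j.factorial : ℝ))
      rw [one_mul] at this
      refine this.congr fun n => ?_
      have := j.factorial_pos
      simp only [Pi.div_apply]
      field_simp
    · filter_upwards [eventually_gt_atTop 0] with n hn
      positivity
  have h2 : Tendsto (fun n : ℕ => (((n - d : ℕ) : ℝ) / n)) atTop (𝓝 1) := by
    have := (tendsto_const_div_atTop_nhds_zero_nat (d : ℝ)).const_sub 1
    rw [sub_zero] at this
    refine this.congr' ?_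
    filter_upwards [eventually_gt_atTop d] with n hn
    have : (0 : ℝ) < n := by exact_mod_cast (by omega : 0 < n)
    rw [Nat.cast_sub hn.le]
    field_simp
  have h3 := (h1.comp (tendsto_sub_atTop_nat d)).mul (h2.pow j)
  rw [one_pow, mul_one] at h3
  refine h3.congr' ?_
  filter_upwards [eventually_gt_atTop d] with n hn
  have h4 : (0 : ℝ) < (n - d : ℕ) := by exact_mod_cast (by omega : 0 < n - d)
  simp only [Function.comp_apply]
  rw [div_pow, div_mul_div_cancel₀ (by positivity)]

theorem tendsto_choose_sub_div_pow_of_lt (d : ℕ) {j s : ℕ} (h : j < s) :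
    Tendsto (fun n : ℕ => (((n - d).choose j : ℕ) : ℝ) / (n : ℝ) ^ s) atTop (𝓝 0) := by
  have h1 : Tendsto (fun n : ℕ => ((n : ℝ) ^ (s - j))⁻¹) atTop (𝓝 0) :=
    tendsto_inv_atTop_zero.comp
      ((tendsto_pow_atTop (by omega)).comp tendsto_natCast_atTop_atTop)
  have h2 := (tendsto_choose_sub_div_pow d j).mul h1
  rw [mul_zero] at h2
  refine h2.congr fun n => ?_
  rw [← div_eq_mul_inv, div_div, ← pow_add, Nat.add_sub_cancel' h.le]

theorem tendsto_autCount_div (s : ℕ) :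
    Tendsto (fun n : ℕ => (autCount n (2 * s) : ℝ) / ((planeTrees n).card * (n : ℝ) ^ s)) atTop
      (𝓝 ((1 / 4) ^ s / s.factorial)) := by
  have hterm : ∀ j ∈ Finset.range (s + 1), Tendsto (fun n : ℕ =>
      (((planeTrees (n - (2 * s - j))).card : ℝ) / (planeTrees n).card) *
        ((((n - (2 * s - j)).choose j : ℕ) : ℝ) / (n : ℝ) ^ s) *
          PowerSeries.coeff (2 * s) (crossSeries ^ j)) atTop
      (𝓝 (if j = s then (1 / 4) ^ s / s.factorial else 0)) := by
    intro j hj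
    rw [Finset.mem_range] at hj
    split_ifs with hjs
    · subst hjs
      have := ((tendsto_card_planeTrees_sub_div (2 * j - j)).mul
        (tendsto_choose_sub_div_pow (2 * j - j) j)).mul_const
          (PowerSeries.coeff (2 * j) (crossSeries ^ j))
      rw [coeff_crossSeries_pow_self, mul_one, show 2 * j - j = j by omega, mul_one_div] at this
      rw [coeff_crossSeries_pow_self, show 2 * j - j = j by omega]
      simpa only [mul_one] using this
    · have := ((tendsto_card_planeTrees_sub_div (2 * s - j)).mul
        (tendsto_choose_sub_div_pow_of_lt (2 * s - j) (by omega : j < s))).mul_const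
          (PowerSeries.coeff (2 * s) (crossSeries ^ j))
      simpa only [mul_zero, zero_mul] using this
  have h := tendsto_finsetSum _ hterm
  rw [Finset.sum_ite_eq_of_mem' _ _ _ (Finset.self_mem_range_succ s)] at h
  refine h.congr' ?_
  filter_upwards [eventually_ge_atTop (2 * s)] with n hn
  have hcast : (autCount n (2 * s) : ℝ) = (autPoly n).coeff (2 * s) :=
    (coeff_autPoly_eq_card n (2 * s)).symm
  rw [hcast, coeff_autPoly_two_mul hn, Finset.sum_div]
  refine Finset.sum_congr rfl fun j hj => ?_
  rw [Finset.mem_range] at hj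
  rw [show n - 2 * s + j = n - (2 * s - j) by omega]
  ring

theorem pow_div_factorial_le_pow_div_factorial {j s n : ℕ} (hj : j ≤ s) (hs : s ≤ n) :
    (n : ℝ) ^ j / j.factorial ≤ (n : ℝ) ^ s / s.factorial := by
  rw [div_le_div_iff₀ (by positivity) (by positivity)]
  have h1 : j.factorial * s.descFactorial (s - j) = s.factorial := by
    have := Nat.factorial_mul_descFactorial (Nat.sub_le s j)
    rwa [Nat.sub_sub_self hj] at this
  have h2 : s.factorial ≤ j.factorial * n ^ (s - j) := by
    rw [← h1]
    exact Nat.mul_le_mul_left _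
      ((Nat.descFactorial_le_pow _ _).trans (Nat.pow_le_pow_left hs _))
  have h3 : n ^ j * s.factorial ≤ n ^ s * j.factorial := by
    calc n ^ j * s.factorial ≤ n ^ j * (j.factorial * n ^ (s - j)) := Nat.mul_le_mul_left _ h2
      _ = n ^ (j + (s - j)) * j.factorial := by rw [pow_add]; ring
      _ = _ := by rw [Nat.add_sub_cancel' hj]
  exact_mod_cast h3

theorem autCount_le {n s : ℕ} (h : 2 * s ≤ n) :
    (autCount n (2 * s) : ℝ) ≤
      (planeTrees n).card * (512 ^ s * ((n : ℝ) ^ s / s.factorial)) := by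
  have hcast : (autCount n (2 * s) : ℝ) = (autPoly n).coeff (2 * s) :=
    (coeff_autPoly_eq_card n (2 * s)).symm
  rw [hcast, coeff_autPoly_two_mul h]
  have hterm : ∀ j ∈ Finset.range (s + 1),
      ((planeTrees (n - 2 * s + j)).card : ℝ) * ((n - 2 * s + j).choose j : ℕ) *
          PowerSeries.coeff (2 * s) (crossSeries ^ j) ≤
        (planeTrees n).card * ((n : ℝ) ^ s / s.factorial) * 16 ^ (2 * s) := by
    intro j hj
    rw [Finset.mem_range] at hj
    have h1 : ((planeTrees (n - 2 * s + j)).card : ℝ) ≤ (planeTrees n).card := by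
      exact_mod_cast monotone_card_planeTrees (by omega : n - 2 * s + j ≤ n)
    have h2 : (((n - 2 * s + j).choose j : ℕ) : ℝ) ≤ (n : ℝ) ^ s / s.factorial := by
      calc (((n - 2 * s + j).choose j : ℕ) : ℝ) ≤ (n.choose j : ℕ) := by
            exact_mod_cast Nat.choose_le_choose j (by omega : n - 2 * s + j ≤ n)
        _ ≤ (n : ℝ) ^ j / j.factorial := Nat.choose_le_pow_div j n
        _ ≤ _ := pow_div_factorial_le_pow_div_factorial (by omega) (by omega)
    exact mul_le_mul (mul_le_mul h1 h2 (Nat.cast_nonneg _) (Nat.cast_nonneg _))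
      (coeff_crossSeries_pow_le j (2 * s)) (coeff_crossSeries_pow_nonneg j _) (by positivity)
  refine (Finset.sum_le_card_nsmul _ _ _ hterm).trans ?_
  rw [Finset.card_range, nsmul_eq_mul]
  have h3 : ((s + 1 : ℕ) : ℝ) ≤ 2 ^ s := by exact_mod_cast Nat.lt_two_pow_self
  calc ((s + 1 : ℕ) : ℝ) * ((planeTrees n).card * ((n : ℝ) ^ s / s.factorial) * 16 ^ (2 * s))
      ≤ 2 ^ s * ((planeTrees n).card * ((n : ℝ) ^ s / s.factorial) * 16 ^ (2 * s)) :=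
        mul_le_mul_of_nonneg_right h3 (by positivity)
    _ = (planeTrees n).card * ((2 * 16 ^ 2) ^ s * ((n : ℝ) ^ s / s.factorial)) := by
        rw [mul_pow, ← pow_mul]; ring
    _ = _ := by norm_num

/-- The number of pairs of a plane tree with `n` leaves and a set of `s` of its cherries. -/
noncomputable def cherryCount (n s : ℕ) : ℕ :=
  ∑ T ∈ planeTrees n, (cherryLeaves T).card.choose s

theorem cherryCount_eq {n s : ℕ} (h : 2 * s ≤ n) :
    (cherryCount n s : ℝ) = ((planeTrees (n - s)).card : ℝ) * ((n - s).choose s : ℕ) := by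
  rw [cherryCount, Nat.cast_sum, sum_choose_card_cherryLeaves h,
    show n - 2 * s + s = n - s by omega]

theorem tendsto_cherryCount_div (s : ℕ) :
    Tendsto (fun n : ℕ => (cherryCount n s : ℝ) / ((planeTrees n).card * (n : ℝ) ^ s)) atTop
      (𝓝 ((1 / 4) ^ s / s.factorial)) := by
  have h := (tendsto_card_planeTrees_sub_div s).mul (tendsto_choose_sub_div_pow s s)
  rw [mul_one_div] at h
  refine h.congr' ?_
  filter_upwards [eventually_ge_atTop (2 * s)] with n hn
  rw [cherryCount_eq hn, div_mul_div_comm]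

theorem cherryCount_le {n s : ℕ} (h : 2 * s ≤ n) :
    (cherryCount n s : ℝ) ≤
      (planeTrees n).card * (512 ^ s * ((n : ℝ) ^ s / s.factorial)) := by
  rw [cherryCount_eq h]
  have h1 : ((planeTrees (n - s)).card : ℝ) ≤ (planeTrees n).card := by
    exact_mod_cast monotone_card_planeTrees (Nat.sub_le n s)
  have h2 : (((n - s).choose s : ℕ) : ℝ) ≤ (n : ℝ) ^ s / s.factorial :=
    (by exact_mod_cast Nat.choose_le_choose s (Nat.sub_le n s) :
      (((n - s).choose s : ℕ) : ℝ) ≤ (n.choose s : ℕ)).trans (Nat.choose_le_pow_div s n)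
  refine mul_le_mul h1 (h2.trans ?_) (Nat.cast_nonneg _) (Nat.cast_nonneg _)
  exact le_mul_of_one_le_left (by positivity) (one_le_pow₀ (by norm_num))

end PTree

namespace PTree

open Filter Topology

theorem tendsto_pow_mul_factorial_div (k : ℕ) :
    Tendsto (fun n : ℕ => (n : ℝ) ^ k * (n - k).factorial / n.factorial) atTop (𝓝 1) := by
  have h := (Asymptotics.isEquivalent_iff_tendsto_one ?_).1 (isEquivalent_descFactorial k).symm
  · refine h.congr' ?_
    filter_upwards [eventually_ge_atTop k] with n hn
    have h1 : ((n - k).factorial : ℝ) * n.descFactorial k = n.factorial := by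
      exact_mod_cast Nat.factorial_mul_descFactorial hn
    have h2 : (0 : ℝ) < n.descFactorial k := by exact_mod_cast Nat.descFactorial_pos.2 hn
    have h3 := (n - k).factorial_pos
    simp only [Pi.div_apply]
    rw [← h1]
    field_simp
  · filter_upwards [eventually_ge_atTop k] with n hn
    exact_mod_cast (Nat.descFactorial_pos.2 hn).ne'

theorem pow_mul_factorial_div_le {k n : ℕ} (h : k ≤ n) :
    (n : ℝ) ^ k * (n - k).factorial / n.factorial ≤ Real.exp k := by
  have h1 : n ^ k * k.factorial ≤ k ^ k * n.descFactorial k := by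
    rw [← Nat.descFactorial_self, Nat.descFactorial_eq_prod_range, Nat.descFactorial_eq_prod_range,
      ← Finset.card_range k, ← Finset.prod_const, ← Finset.prod_const, Finset.card_range,
      ← Finset.prod_mul_distrib, ← Finset.prod_mul_distrib]
    refine Finset.prod_le_prod' fun i _ => ?_
    rw [Nat.mul_sub, Nat.mul_sub, mul_comm n k]
    exact Nat.sub_le_sub_left (Nat.mul_le_mul_right i h) _
  have h2 : ((n - k).factorial : ℝ) * n.descFactorial k = n.factorial := by
    exact_mod_cast Nat.factorial_mul_descFactorial h
  have h3 : (0 : ℝ) < n.descFactorial k := by exact_mod_cast Nat.descFactorial_pos.2 h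
  have h4 : (n : ℝ) ^ k * k.factorial ≤ (k : ℝ) ^ k * n.descFactorial k := by exact_mod_cast h1
  refine le_trans ?_ (Real.pow_div_factorial_le_exp (k : ℝ) (Nat.cast_nonneg k) k)
  rw [← h2, div_le_div_iff₀ (mul_pos (by positivity) h3) (by positivity)]
  nlinarith [mul_le_mul_of_nonneg_right h4 (Nat.cast_nonneg (α := ℝ) (n - k).factorial)]

/-- The contribution of `s` to the average number of automorphisms of a triple when there are
`a` marked structures moving `2 s` leaves on the trees with `n` leaves. -/
noncomputable def normalizedTerm (a : ℕ → ℕ → ℕ) (n s : ℕ) : ℝ :=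
  (a n s : ℝ) ^ 2 * involutionWeight n s / ((planeTrees n).card ^ 2 * n.factorial)

theorem normalizedTerm_eq (a : ℕ → ℕ → ℕ) {n : ℕ} (hn : 0 < n) (s : ℕ) :
    normalizedTerm a n s = ((a n s : ℝ) / ((planeTrees n).card * (n : ℝ) ^ s)) ^ 2 *
      (2 ^ s * s.factorial) * ((n : ℝ) ^ (2 * s) * (n - 2 * s).factorial / n.factorial) := by
  have hn' : (0 : ℝ) < n := by exact_mod_cast hn
  rw [normalizedTerm, involutionWeight, div_pow, mul_pow, ← pow_mul, mul_comm s 2]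
  push_cast
  have h1 := n.factorial_pos
  field_simp

theorem tendsto_normalizedTerm {a : ℕ → ℕ → ℕ} {s : ℕ}
    (ha : Tendsto (fun n : ℕ => (a n s : ℝ) / ((planeTrees n).card * (n : ℝ) ^ s)) atTop
      (𝓝 ((1 / 4) ^ s / s.factorial))) :
    Tendsto (fun n => normalizedTerm a n s) atTop (𝓝 ((1 / 8) ^ s / s.factorial)) := by
  have h := ((ha.pow 2).mul_const (2 ^ s * (s.factorial : ℝ))).mul
    (tendsto_pow_mul_factorial_div (2 * s))
  have hval : ((1 / 4 : ℝ) ^ s / s.factorial) ^ 2 * (2 ^ s * s.factorial) * 1 =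
      (1 / 8) ^ s / s.factorial := by
    have h1 := s.factorial_pos
    rw [show (1 / 8 : ℝ) = 1 / 4 * (1 / 4) * 2 by norm_num, mul_pow, mul_pow]
    field_simp
  rw [hval] at h
  refine h.congr' ?_
  filter_upwards [eventually_gt_atTop 0] with n hn
  rw [normalizedTerm_eq a hn]

theorem normalizedTerm_nonneg (a : ℕ → ℕ → ℕ) (n s : ℕ) : 0 ≤ normalizedTerm a n s := by
  unfold normalizedTerm
  positivity

theorem normalizedTerm_le {a : ℕ → ℕ → ℕ} {n s : ℕ} (hn : 0 < n) (hs : 2 * s ≤ n)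
    (ha : (a n s : ℝ) ≤ (planeTrees n).card * (512 ^ s * ((n : ℝ) ^ s / s.factorial))) :
    normalizedTerm a n s ≤ (512 ^ 2 * 2 * Real.exp 2) ^ s / s.factorial := by
  have hn' : (0 : ℝ) < n := by exact_mod_cast hn
  have hc : (0 : ℝ) < (planeTrees n).card := by
    obtain ⟨m, rfl⟩ := Nat.exists_eq_succ_of_ne_zero hn.ne'
    exact_mod_cast card_planeTrees_pos m
  have hf : (0 : ℝ) < s.factorial := by exact_mod_cast s.factorial_pos
  have h1 : (a n s : ℝ) / ((planeTrees n).card * (n : ℝ) ^ s) ≤ 512 ^ s / s.factorial := by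
    rw [div_le_iff₀ (by positivity)]
    refine ha.trans_eq ?_
    field_simp
  have h2 := pow_mul_factorial_div_le hs
  rw [normalizedTerm_eq a hn]
  calc _ ≤ ((512 : ℝ) ^ s / s.factorial) ^ 2 * (2 ^ s * s.factorial) *
        Real.exp ((2 * s : ℕ) : ℝ) := by gcongr
    _ = _ := by
      rw [Nat.cast_mul, mul_comm ((2 : ℕ) : ℝ), Real.exp_nat_mul, mul_pow, mul_pow, ← pow_mul,
        mul_comm 2 s, pow_mul]
      push_cast
      field_simp

theorem tendsto_sum_normalizedTerm {a : ℕ → ℕ → ℕ}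
    (hlim : ∀ s, Tendsto (fun n : ℕ => (a n s : ℝ) / ((planeTrees n).card * (n : ℝ) ^ s)) atTop
      (𝓝 ((1 / 4) ^ s / s.factorial)))
    (hle : ∀ n s, 2 * s ≤ n →
      (a n s : ℝ) ≤ (planeTrees n).card * (512 ^ s * ((n : ℝ) ^ s / s.factorial)))
    {w : ℕ → ℝ} {C : ℝ} (hw : ∀ s, |w s| ≤ C ^ s) :
    Tendsto (fun n => ∑ s ∈ Finset.range (n / 2 + 1), w s * normalizedTerm a n s) atTop
      (𝓝 (∑' s, w s * ((1 / 8) ^ s / s.factorial))) := by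
  have h := tendsto_tsum_of_dominated_convergence (𝓕 := atTop)
    (f := fun n s => if s ∈ Finset.range (n / 2 + 1) then w s * normalizedTerm a n s else 0)
    (g := fun s => w s * ((1 / 8 : ℝ) ^ s / s.factorial))
    (Real.summable_pow_div_factorial (C * (512 ^ 2 * 2 * Real.exp 2))) ?_ ?_
  · refine h.congr fun n => ?_
    rw [tsum_eq_sum (s := Finset.range (n / 2 + 1)) fun s hs => if_neg hs]
    exact Finset.sum_congr rfl fun s hs => if_pos hs
  · intro s
    refine ((tendsto_normalizedTerm (hlim s)).const_mul (w s)).congr' ?_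
    filter_upwards [eventually_ge_atTop (2 * s)] with n hn
    rw [if_pos (Finset.mem_range.2 (by omega))]
  · filter_upwards [eventually_gt_atTop 0] with n hn s
    have hC : 0 ≤ C ^ s := (abs_nonneg _).trans (hw s)
    rw [mul_pow, mul_div_assoc]
    split_ifs with hs
    · rw [Finset.mem_range] at hs
      rw [Real.norm_eq_abs, abs_mul, abs_of_nonneg (normalizedTerm_nonneg a n s)]
      exact mul_le_mul (hw s) (normalizedTerm_le hn (by omega) (hle n s (by omega)))
        (normalizedTerm_nonneg a n s) hC
    · rw [norm_zero]
      positivity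

theorem sum_alternating_choose_mul_choose {M N : ℕ} (k : ℕ) (h : M ≤ N) :
    ∑ s ∈ Finset.range (N + 1), (-1 : ℝ) ^ (s + k) * s.choose k * M.choose s =
      if M = k then 1 else 0 := by
  rcases lt_or_ge M k with hk | hk
  · rw [if_neg hk.ne]
    refine Finset.sum_eq_zero fun s _ => ?_
    rcases lt_or_ge s k with hs | hs
    · rw [Nat.choose_eq_zero_of_lt hs]; simp
    · rw [Nat.choose_eq_zero_of_lt (hk.trans_le hs)]; simp
  · have hsub : ∑ s ∈ Finset.range (M + 1), (-1 : ℝ) ^ (s + k) * s.choose k * M.choose s =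
        ∑ s ∈ Finset.range (N + 1), (-1 : ℝ) ^ (s + k) * s.choose k * M.choose s := by
      refine Finset.sum_subset (Finset.range_subset_range.2 (by omega)) fun s _ hs => ?_
      rw [Finset.mem_range] at hs
      rw [Nat.choose_eq_zero_of_lt (by omega : M < s)]
      simp
    rw [← hsub, show M + 1 = k + (M - k + 1) by omega, Finset.sum_range_add,
      Finset.sum_eq_zero, zero_add]
    · have halt := Int.alternating_sum_range_choose (n := M - k)
      have hcast : ∑ t ∈ Finset.range (M - k + 1), (-1 : ℝ) ^ t * (M - k).choose t =
          if M - k = 0 then 1 else 0 := by exact_mod_cast halt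
      calc _ = M.choose k * ∑ t ∈ Finset.range (M - k + 1), (-1 : ℝ) ^ t * (M - k).choose t := by
            rw [Finset.mul_sum]
            refine Finset.sum_congr rfl fun t _ => ?_
            have hmul : (M.choose (k + t) : ℝ) * (k + t).choose k =
                M.choose k * (M - k).choose t := by
              have := Nat.choose_mul (n := M) (Nat.le_add_right k t)
              rw [Nat.add_sub_cancel_left] at this
              exact_mod_cast this
            have hsign : (-1 : ℝ) ^ (k + t + k) = (-1) ^ t := by
              rw [add_right_comm, pow_add, ← two_mul, pow_mul]; simp
            rw [hsign]
            linear_combination (-1 : ℝ) ^ t * hmul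
        _ = _ := by
            rw [hcast]
            rcases hk.eq_or_lt with rfl | hlt
            · simp
            · rw [if_neg (by omega), if_neg hlt.ne', mul_zero]
    · intro s hs
      rw [Nat.choose_eq_zero_of_lt (Finset.mem_range.1 hs)]
      simp

theorem tsum_alternating_choose (k : ℕ) (x : ℝ) :
    ∑' s : ℕ, (-1 : ℝ) ^ (s + k) * s.choose k * (x ^ s / s.factorial) =
      x ^ k / k.factorial * Real.exp (-x) := by
  have hexp : HasSum (fun t : ℕ => (-x) ^ t / t.factorial) (Real.exp (-x)) := by
    rw [Real.exp_eq_exp_ℝ]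
    exact NormedSpace.expSeries_div_hasSum_exp (-x)
  have h := hexp.mul_left (x ^ k / k.factorial)
  have hinj : Function.Injective fun t : ℕ => t + k := add_left_injective k
  refine HasSum.tsum_eq ((hinj.hasSum_iff ?_).1 ?_)
  · intro s hs
    have : s < k := by
      by_contra hks
      exact hs ⟨s - k, by simp only; omega⟩
    rw [Nat.choose_eq_zero_of_lt this]
    simp
  · refine h.congr_fun ?_
    intro t
    have hmul : ((t + k).choose k : ℝ) * t.factorial * k.factorial = (t + k).factorial := by
      have := Nat.choose_mul_factorial_mul_factorial (Nat.le_add_left k t)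
      rw [Nat.add_sub_cancel] at this
      have h2 : ((t + k).choose k : ℝ) * k.factorial * t.factorial = (t + k).factorial := by
        exact_mod_cast this
      linarith
    have hsign : (-1 : ℝ) ^ (t + k + k) = (-1) ^ t := by
      rw [add_assoc, pow_add, ← two_mul, pow_mul]; simp
    have h1 := t.factorial_pos
    have h2 := k.factorial_pos
    have h3 : (0 : ℝ) < (t + k).choose k := by
      exact_mod_cast Nat.choose_pos (Nat.le_add_left k t)
    simp only [Function.comp_apply]
    rw [hsign, ← hmul, neg_pow x, pow_add]
    field_simp

end PTree

namespace PTree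

open Filter Topology

theorem card_cherryLeaves_le {T : PTree} {n : ℕ} (hT : T.size = n) :
    (cherryLeaves T).card ≤ n / 2 := by
  have h := card_support_flipPerm (isTransversal_cherryLeaves T) subset_rfl
  have hle := Finset.card_le_univ
    (flipPerm (isTransversal_cherryLeaves T).involutive (cherryLeaves T)).support
  rw [h, card_leaf, hT] at hle
  omega

theorem matchNum_le {T S : PTree} {n : ℕ} (hT : T.size = n) (v : Leaf T ≃ Leaf S) :
    matchNum v ≤ n / 2 :=
  (Finset.card_le_card (Finset.filter_subset _ _)).trans (card_cherryLeaves_le hT)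

/-- The average of `f` over all triples of two plane trees with `n` leaves and a matching. -/
noncomputable def tripleAvg (n : ℕ) (f : ∀ T S : PTree, (Leaf T ≃ Leaf S) → ℝ) : ℝ :=
  (∑ T ∈ planeTrees n, ∑ S ∈ planeTrees n, ∑ v : Leaf T ≃ Leaf S, f T S v) /
    ((planeTrees n).card ^ 2 * n.factorial)

theorem tripleAvg_mono {n : ℕ} {f g : ∀ T S : PTree, (Leaf T ≃ Leaf S) → ℝ}
    (h : ∀ T S v, f T S v ≤ g T S v) : tripleAvg n f ≤ tripleAvg n g :=
  div_le_div_of_nonneg_right (Finset.sum_le_sum fun T _ => Finset.sum_le_sum fun S _ =>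
    Finset.sum_le_sum fun v _ => h T S v) (by positivity)

theorem tripleAvg_congr {n : ℕ} {f g : ∀ T S : PTree, (Leaf T ≃ Leaf S) → ℝ}
    (h : ∀ T S v, T.size = n → f T S v = g T S v) : tripleAvg n f = tripleAvg n g := by
  rw [tripleAvg, tripleAvg]
  congr 1
  exact Finset.sum_congr rfl fun T hT => Finset.sum_congr rfl fun S _ =>
    Finset.sum_congr rfl fun v _ => h T S v (mem_planeTrees.1 hT)

theorem tripleAvg_sub (n : ℕ) (f g : ∀ T S : PTree, (Leaf T ≃ Leaf S) → ℝ) :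
    tripleAvg n (fun T S v => f T S v - g T S v) = tripleAvg n f - tripleAvg n g := by
  simp only [tripleAvg, Finset.sum_sub_distrib, sub_div]

theorem tripleAvg_const_mul (n : ℕ) (c : ℝ) (f : ∀ T S : PTree, (Leaf T ≃ Leaf S) → ℝ) :
    tripleAvg n (fun T S v => c * f T S v) = c * tripleAvg n f := by
  simp only [tripleAvg, ← Finset.mul_sum, mul_div_assoc]

theorem tripleAvg_sum (n : ℕ) (t : Finset ℕ) (f : ℕ → ∀ T S : PTree, (Leaf T ≃ Leaf S) → ℝ) :
    tripleAvg n (fun T S v => ∑ s ∈ t, f s T S v) = ∑ s ∈ t, tripleAvg n (f s) := by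
  simp only [tripleAvg, ← Finset.sum_div]
  congr 1
  simp_rw [Finset.sum_comm (t := t)]

theorem tripleAvg_choose_matchNum (n s : ℕ) :
    tripleAvg n (fun _ _ v => ((matchNum v).choose s : ℝ)) = normalizedTerm cherryCount n s := by
  rw [tripleAvg, normalizedTerm, cherryCount]
  congr 1
  exact_mod_cast sum_choose_matchNum n s

theorem tsum_pow_div_factorial (x : ℝ) : ∑' s : ℕ, x ^ s / s.factorial = Real.exp x := by
  rw [Real.exp_eq_exp_ℝ]
  exact (NormedSpace.expSeries_div_hasSum_exp x).tsum_eq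

theorem tendsto_tripleAvg_two_pow_matchNum :
    Tendsto (fun n => tripleAvg n fun _ _ v => (2 : ℝ) ^ matchNum v) atTop
      (𝓝 (Real.exp (1 / 8))) := by
  have h := tendsto_sum_normalizedTerm tendsto_cherryCount_div (fun _ _ => cherryCount_le)
    (w := fun _ => 1) (C := 1) (by simp)
  simp_rw [one_mul, tsum_pow_div_factorial] at h
  refine h.congr fun n => ?_
  simp_rw [← tripleAvg_choose_matchNum]
  rw [← tripleAvg_sum]
  refine tripleAvg_congr fun T S v hT => ?_
  have hsum : ∑ s ∈ Finset.range (matchNum v + 1), (matchNum v).choose s = 2 ^ matchNum v :=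
    Nat.sum_range_choose _
  have hext : ∑ s ∈ Finset.range (matchNum v + 1), (matchNum v).choose s =
      ∑ s ∈ Finset.range (n / 2 + 1), (matchNum v).choose s := by
    have := matchNum_le hT v
    refine Finset.sum_subset (Finset.range_subset_range.2 (by omega)) fun s _ hs => ?_
    rw [Finset.mem_range] at hs
    exact Nat.choose_eq_zero_of_lt (by omega)
  rw [hext] at hsum
  exact_mod_cast hsum

theorem tendsto_tripleAvg_matchNum_eq (k : ℕ) :
    Tendsto (fun n => tripleAvg n fun _ _ v => if matchNum v = k then 1 else 0) atTop
      (𝓝 ((1 / 8) ^ k / k.factorial * Real.exp (-(1 / 8)))) := by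
  have h := tendsto_sum_normalizedTerm tendsto_cherryCount_div (fun _ _ => cherryCount_le)
    (w := fun s => (-1) ^ (s + k) * s.choose k) (C := 2) (fun s => ?_)
  · rw [tsum_alternating_choose] at h
    refine h.congr fun n => ?_
    simp_rw [← tripleAvg_choose_matchNum, ← tripleAvg_const_mul]
    rw [← tripleAvg_sum]
    exact tripleAvg_congr fun T S v hT =>
      sum_alternating_choose_mul_choose k (matchNum_le hT v)
  · rw [abs_mul, abs_pow, abs_neg, abs_one, one_pow, one_mul, Nat.abs_cast]
    exact_mod_cast Nat.choose_le_two_pow s k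

theorem tendsto_tripleAvg_card_tangleIsos :
    Tendsto (fun n => tripleAvg n fun _ _ v => ((tangleIsos v v).card : ℝ)) atTop
      (𝓝 (Real.exp (1 / 8))) := by
  have h := tendsto_sum_normalizedTerm (a := fun n s => autCount n (2 * s)) tendsto_autCount_div
    (fun _ _ => autCount_le) (w := fun _ => 1) (C := 1) (by simp)
  simp_rw [one_mul, tsum_pow_div_factorial] at h
  refine tendsto_of_tendsto_of_tendsto_of_le_of_le tendsto_tripleAvg_two_pow_matchNum h
    (fun n => tripleAvg_mono fun T S v => ?_) fun n => ?_
  · exact_mod_cast two_pow_card_matched_le v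
  · simp only [normalizedTerm, tripleAvg]
    rw [← Finset.sum_div]
    refine div_le_div_of_nonneg_right ?_ (by positivity)
    exact_mod_cast sum_sum_card_tangleIsos_le n

theorem tendsto_tripleAvg_card_tangleIsos_matchNum_eq (k : ℕ) :
    Tendsto (fun n => tripleAvg n fun _ _ v =>
        if matchNum v = k then ((tangleIsos v v).card : ℝ) else 0) atTop
      (𝓝 (2 ^ k * ((1 / 8) ^ k / k.factorial * Real.exp (-(1 / 8))))) := by
  have hlow := (tendsto_tripleAvg_matchNum_eq k).const_mul (2 ^ k)
  have hupp := hlow.add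
    (tendsto_tripleAvg_card_tangleIsos.sub tendsto_tripleAvg_two_pow_matchNum)
  rw [sub_self, add_zero] at hupp
  refine tendsto_of_tendsto_of_tendsto_of_le_of_le hlow hupp (fun n => ?_) fun n => ?_
  · simp only
    rw [← tripleAvg_const_mul]
    refine tripleAvg_mono fun T S v => ?_
    have h : (2 : ℝ) ^ matchNum v ≤ (tangleIsos v v).card := by
      exact_mod_cast two_pow_card_matched_le v
    split_ifs with hk
    · rwa [mul_one, ← hk]
    · rw [mul_zero]
  · simp only
    rw [← tripleAvg_const_mul, ← tripleAvg_sub, ← sub_le_iff_le_add', ← tripleAvg_sub]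
    refine tripleAvg_mono fun T S v => ?_
    have h : (2 : ℝ) ^ matchNum v ≤ (tangleIsos v v).card := by
      exact_mod_cast two_pow_card_matched_le v
    split_ifs with hk
    · rw [mul_one, ← hk]
    · simpa using h

theorem tangleProb_matchedCherries_eq {n : ℕ} (hn : 0 < n) (k : ℕ) :
    tangleProb n (fun t => matchedCherries t.1 t.2.1 t.2.2 = k) =
      (tripleAvg n fun _ _ v => if matchNum v = k then ((tangleIsos v v).card : ℝ) else 0) /
        tripleAvg n fun _ _ v => ((tangleIsos v v).card : ℝ) := by
  have hc : (0 : ℝ) < (planeTrees n).card := by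
    obtain ⟨m, rfl⟩ := Nat.exists_eq_succ_of_ne_zero hn.ne'
    exact_mod_cast card_planeTrees_pos m
  have hf : (0 : ℝ) < n.factorial := by exact_mod_cast n.factorial_pos
  rw [tripleAvg, tripleAvg, div_div_div_cancel_right₀ (by positivity), tangleProb,
    ← mul_div_mul_right _ _ (pow_ne_zero n (four_ne_zero (α := ℝ))),
    ← mul_div_mul_left (∑ T ∈ planeTrees n, _) _ (four_ne_zero (α := ℝ))]
  congr 1
  · have key := congrArg (Nat.cast (R := ℝ)) (card_filter_matchedCherries_mul n k)
    push_cast at key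
    convert key
    rfl
  · exact_mod_cast numTanglegrams_mul n

end PTree

open PTree in
/-- Theorem 8 (first part): the number of matched cherries of a random tanglegram of
size `n` converges in distribution to Poisson with mean `1/4`:
`P(exactly k matched cherries) → e^(-1/4) 4^(-k)/k!`. -/
theorem matched_cherries_poisson (k : ℕ) :
    Filter.Tendsto
      (fun n : ℕ => tangleProb n
        (fun t => matchedCherries t.1 t.2.1 t.2.2 = k))
      Filter.atTop
      (nhds (Real.exp (-(1 / 4)) * (1 / 4 : ℝ) ^ k / (Nat.factorial k : ℝ))) := by
  have h := (tendsto_tripleAvg_card_tangleIsos_matchNum_eq k).div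
    tendsto_tripleAvg_card_tangleIsos (Real.exp_pos _).ne'
  have hval : 2 ^ k * ((1 / 8) ^ k / k.factorial * Real.exp (-(1 / 8))) / Real.exp (1 / 8) =
      Real.exp (-(1 / 4)) * (1 / 4 : ℝ) ^ k / (Nat.factorial k : ℝ) := by
    rw [show (-(1 / 4) : ℝ) = -(1 / 8) - 1 / 8 by norm_num, Real.exp_sub,
      show (1 / 4 : ℝ) = 2 * (1 / 8) by norm_num, mul_pow]
    ring
  rw [hval] at h
  refine h.congr' ?_
  filter_upwards [Filter.eventually_gt_atTop 0] with n hn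
  exact (tangleProb_matchedCherries_eq hn k).symm
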